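/- arXiv:1201.5361 — 6 statements merged into one kernel-verified Lean document; each statement's English description precedes it below -/
import Mathlib

section
/- The graph K_2 + H_7 is not 5-colorable. -/
open SimpleGraph

/-- The join `K + L` of two graphs: disjoint union plus all cross edges. -/
def graphJoin {V W : Type*} (G : SimpleGraph V) (H : SimpleGraph W) :
    SimpleGraph (V ⊕ W) :=
  SimpleGraph.fromRel fun x y =>
    match x, y with
    | Sum.inl a, Sum.inl b => G.Adj a b
    | Sum.inr a, Sum.inr b => H.Adj a b
    | Sum.inl _, Sum.inr _ => True
    | Sum.inr _, Sum.inl _ => False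

/-- The cycle `C_n` on `n` vertices (vertex set `ZMod n`, `i ~ j` iff `i - j = ±1`). -/
def cyc (n : ℕ) : SimpleGraph (ZMod n) :=
  SimpleGraph.fromRel fun i j => i - j = 1

/-- The Moser spindle `H_7`: vertices `0 = z, 1 = a1, 2 = a2, 3 = b, 4 = c1, 5 = c2, 6 = d`. -/
def H7 : SimpleGraph (Fin 7) :=
  SimpleGraph.fromRel fun i j => (i.val, j.val) ∈
    [(0,1), (0,2), (1,2), (1,3), (2,3), (0,4), (0,5), (4,5), (4,6), (5,6), (3,6)]

/-- `M_7`: vertices `0..5 = x1..x6` on a 6-cycle with chords `x1x3, x3x5, x5x1`,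
and `6 = v` joined to `x2, x4, x6`. -/
def M7 : SimpleGraph (Fin 7) :=
  SimpleGraph.fromRel fun i j => (i.val, j.val) ∈
    [(0,1), (1,2), (2,3), (3,4), (4,5), (5,0), (0,2), (2,4), (4,0), (6,1), (6,3), (6,5)]

/-- `T_11`: the graph on `ZMod 11` where distinct `i, j` are adjacent iff
`i - j ≡ ±1, ±2, ±3 (mod 11)`. -/
def T11 : SimpleGraph (ZMod 11) :=
  SimpleGraph.fromRel fun i j => i - j = 1 ∨ i - j = 2 ∨ i - j = 3

theorem graphJoin_adj_inr {V W : Type*} {G : SimpleGraph V} {H : SimpleGraph W} {a b : W}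
    (h : H.Adj a b) : (graphJoin G H).Adj (Sum.inr a) (Sum.inr b) := by
  simp [graphJoin, h, h.ne]

theorem graphJoin_adj_inl {V W : Type*} {G : SimpleGraph V} {H : SimpleGraph W} {a b : V}
    (h : G.Adj a b) : (graphJoin G H).Adj (Sum.inl a) (Sum.inl b) := by
  simp [graphJoin, h, h.ne]

theorem graphJoin_adj_inl_inr {V W : Type*} (G : SimpleGraph V) (H : SimpleGraph W) (a : V)
    (b : W) : (graphJoin G H).Adj (Sum.inl a) (Sum.inr b) := by
  simp [graphJoin]

/-- In a 5-coloring of `K_2 + H`, two vertices of `H` that are both joined to the two ends of an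
edge of `H` receive the same color. -/
theorem coloring_eq_of_adj_edge {W : Type*} {H : SimpleGraph W}
    (c : (graphJoin (⊤ : SimpleGraph (Fin 2)) H).Coloring (Fin 5)) {x y u v : W}
    (huv : H.Adj u v) (hxu : H.Adj x u) (hxv : H.Adj x v) (hyu : H.Adj y u) (hyv : H.Adj y v) :
    c (Sum.inr x) = c (Sum.inr y) := by
  by_contra hxy
  have hpq : c (Sum.inl 0) ≠ c (Sum.inl 1) := c.valid (graphJoin_adj_inl (by simp))
  have hW {a b : W} (h : H.Adj a b) : c (Sum.inr a) ≠ c (Sum.inr b) :=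
    c.valid (graphJoin_adj_inr h)
  have hKW (i : Fin 2) (a : W) : c (Sum.inl i) ≠ c (Sum.inr a) :=
    c.valid (graphJoin_adj_inl_inr _ _ i a)
  have hnodup : [c (Sum.inl 0), c (Sum.inl 1), c (Sum.inr x), c (Sum.inr y), c (Sum.inr u),
      c (Sum.inr v)].Nodup := by
    simp [hpq, hKW, hxy, hW huv, hW hxu, hW hxv, hW hyu, hW hyv]
  simpa using hnodup.length_le_card

/-- The graph `K_2 + H_7` is not 5-colorable. -/
theorem k2_join_h7_not_five_colorable :
    ¬ (graphJoin (⊤ : SimpleGraph (Fin 2)) H7).Colorable 5 := by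
  rintro ⟨c⟩
  have hzb : c (Sum.inr 0) = c (Sum.inr 3) := by
    apply coloring_eq_of_adj_edge c (u := 1) (v := 2) <;> simp [H7]
  have hzd : c (Sum.inr 0) = c (Sum.inr 6) := by
    apply coloring_eq_of_adj_edge c (u := 4) (v := 5) <;> simp [H7]
  have hbd : H7.Adj 3 6 := by simp [H7]
  exact c.valid (graphJoin_adj_inr hbd) (hzb.symm.trans hzd)
end

section
/- Every proper subgraph of T_11 is 5-colorable (so T_11 is 6-critical). -/
open SimpleGraph

/-- For each edge direction `d`, some 5-coloring of `ZMod 11` is monochromatic on no edge of `T11`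
other than the one joining `d` and `0`. -/
theorem exists_coloring_monochromatic_only_at (d : ZMod 11) (hd : d = 1 ∨ d = 2 ∨ d = 3) :
    ∃ c : ZMod 11 → Fin 5, ∀ i j : ZMod 11,
      (i - j = 1 ∨ i - j = 2 ∨ i - j = 3) → c i = c j → i = d ∧ j = 0 := by
  rcases hd with rfl | rfl | rfl
  · exact ⟨(![0, 0, 1, 2, 3, 0, 4, 1, 2, 3, 4] : Fin 11 → Fin 5), by
      unfold ZMod; decide +kernel⟩
  · exact ⟨(![0, 1, 0, 2, 3, 1, 4, 0, 2, 3, 4] : Fin 11 → Fin 5), by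
      unfold ZMod; decide +kernel⟩
  · exact ⟨(![0, 1, 2, 0, 3, 1, 4, 0, 2, 3, 4] : Fin 11 → Fin 5), by
      unfold ZMod; decide +kernel⟩

theorem T11_adj_iff (i j : ZMod 11) :
    T11.Adj i j ↔ (i - j = 1 ∨ i - j = 2 ∨ i - j = 3) ∨ (j - i = 1 ∨ j - i = 2 ∨ j - i = 3) := by
  simp only [T11, SimpleGraph.fromRel_adj, and_iff_right_iff_imp]
  rintro h rfl
  revert h
  rw [sub_self]
  decide

/-- A proper subgraph of a graph without isolated vertices misses an edge. -/
theorem SimpleGraph.Subgraph.exists_adj_not_adj_of_ne_top {V : Type*} {G : SimpleGraph V}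
    (hG : ∀ v, ∃ w, G.Adj v w) {H : G.Subgraph} (hH : H ≠ ⊤) :
    ∃ a b, G.Adj a b ∧ ¬ H.Adj a b := by
  contrapose! hH
  refine SimpleGraph.Subgraph.ext (Set.eq_univ_of_forall fun v => ?_) ?_
  · obtain ⟨w, hw⟩ := hG v
    exact H.edge_vert (hH v w hw)
  · ext a b
    exact ⟨fun h => H.adj_sub h, hH a b⟩

/-- Every proper subgraph of `T_11` is 5-colorable (so `T_11` is 6-critical). -/
theorem t11_proper_subgraphs_five_colorable :
    ∀ H : T11.Subgraph, H ≠ ⊤ → H.coe.Colorable 5 := by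
  intro H hH
  obtain ⟨a, b, hd, hnot⟩ : ∃ a b : ZMod 11,
      (a - b = 1 ∨ a - b = 2 ∨ a - b = 3) ∧ ¬ H.Adj a b := by
    obtain ⟨a, b, hab, hnot⟩ := SimpleGraph.Subgraph.exists_adj_not_adj_of_ne_top
      (fun v => ⟨v + 1, (T11_adj_iff _ _).2 (by simp)⟩) hH
    rcases (T11_adj_iff a b).1 hab with h | h
    · exact ⟨a, b, h, hnot⟩
    · exact ⟨b, a, h, fun h' => hnot h'.symm⟩
  obtain ⟨c, hc⟩ := exists_coloring_monochromatic_only_at (a - b) hd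
  have key : ∀ i j : ZMod 11, (i - j = 1 ∨ i - j = 2 ∨ i - j = 3) → H.Adj i j →
      c (i - b) ≠ c (j - b) := by
    intro i j hij hadj heq
    obtain ⟨hi, hj⟩ := hc (i - b) (j - b) (by rwa [sub_sub_sub_cancel_right]) heq
    rw [sub_left_inj.1 hi, sub_eq_zero.1 hj] at hadj
    exact hnot hadj
  refine ⟨SimpleGraph.Coloring.mk (fun v => c (v.1 - b)) fun {u v} huv => ?_⟩
  have huv' : H.Adj u.1 v.1 := huv
  rcases (T11_adj_iff u.1 v.1).1 huv'.adj_sub with h | h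
  · exact key _ _ h huv'
  · exact (key _ _ h huv'.symm).symm
end

section
/- The graph H_7 is not 3-colorable. -/
open SimpleGraph

/-- In a 3-coloring, the two tips of a diamond (two triangles sharing an edge) have the same
color. -/
theorem SimpleGraph.Coloring.eq_of_diamond {V : Type*} {G : SimpleGraph V}
    (C : G.Coloring (Fin 3)) {u v w x : V} (huv : G.Adj u v) (huw : G.Adj u w)
    (hvw : G.Adj v w) (hvx : G.Adj v x) (hwx : G.Adj w x) : C u = C x := by
  have := C.valid huv
  have := C.valid huw
  have := C.valid hvw
  have := C.valid hvx
  have := C.valid hwx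
  omega

/-- The Moser spindle `H_7` is not 3-colorable. -/
theorem h7_not_three_colorable : ¬ H7.Colorable 3 := by
  rintro ⟨C⟩
  have hb : C 0 = C 3 := by
    apply C.eq_of_diamond (v := 1) (w := 2) <;> simp [H7]
  have hd : C 0 = C 6 := by
    apply C.eq_of_diamond (v := 4) (w := 5) <;> simp [H7]
  have hbd : H7.Adj 3 6 := by simp [H7]
  exact C.valid hbd (hb.symm.trans hd)
end

section
/- Every proper subgraph of H_7 is 3-colorable (so H_7 is 4-critical). -/
open SimpleGraph

instance : DecidableRel H7.Adj := by
  unfold H7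
  infer_instance

/-- A map to `Fin 3` that is proper on `H7` away from the edge `uv`, for each edge `uv` of `H7`
listed with `u < v`; the default value serves the edge joining `3` and `6`. -/
def edgeDeletedColoring (u v : Fin 7) : Fin 7 → Fin 3 :=
  match u.val, v.val with
  | 0, 1 => ![0, 0, 1, 2, 1, 2, 0]
  | 0, 2 => ![0, 1, 0, 2, 1, 2, 0]
  | 1, 2 => ![0, 1, 1, 2, 1, 2, 0]
  | 1, 3 => ![0, 1, 2, 1, 1, 2, 0]
  | 2, 3 => ![0, 1, 2, 2, 1, 2, 0]
  | 0, 4 => ![0, 1, 2, 0, 0, 1, 2]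
  | 0, 5 => ![0, 1, 2, 0, 1, 0, 2]
  | 4, 5 => ![0, 1, 2, 0, 1, 1, 2]
  | 4, 6 => ![0, 1, 2, 0, 1, 2, 1]
  | 5, 6 => ![0, 1, 2, 0, 1, 2, 2]
  | _, _ => ![0, 1, 2, 0, 1, 2, 0]

lemma edgeDeletedColoring_ne : ∀ u v : Fin 7, H7.Adj u v → u < v →
    ∀ x y, H7.Adj x y → s(x, y) ≠ s(u, v) →
      edgeDeletedColoring u v x ≠ edgeDeletedColoring u v y := by
  decide +kernel

lemma exists_H7_adj : ∀ v : Fin 7, ∃ w, H7.Adj v w := by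
  decide +kernel

/-- A subgraph containing every edge of a graph without isolated vertices is the whole graph. -/
lemma SimpleGraph.Subgraph.eq_top_of_forall_adj {V : Type*} {G : SimpleGraph V}
    (hG : ∀ v, ∃ w, G.Adj v w) (H : G.Subgraph) (h : ∀ u v, G.Adj u v → H.Adj u v) :
    H = ⊤ := by
  refine top_le_iff.mp ⟨fun v _ => ?_, fun u v huv => h u v huv⟩
  obtain ⟨w, hw⟩ := hG v
  exact (h v w hw).fst_mem

lemma H7_subgraph_colorable_of_not_adj (H : H7.Subgraph) {u v : Fin 7} (huv : H7.Adj u v)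
    (hlt : u < v) (hH : ¬ H.Adj u v) : H.coe.Colorable 3 := by
  refine ⟨Coloring.mk (fun x => edgeDeletedColoring u v x) fun {x y} hxy => ?_⟩
  have hadj : H.Adj x y := hxy
  refine edgeDeletedColoring_ne u v huv hlt x y hadj.adj_sub fun he => hH ?_
  rwa [← Subgraph.mem_edgeSet, ← he, Subgraph.mem_edgeSet]

/-- Every proper subgraph of `H_7` is 3-colorable (so `H_7` is 4-critical). -/
theorem h7_proper_subgraphs_three_colorable :
    ∀ H : H7.Subgraph, H ≠ ⊤ → H.coe.Colorable 3 := by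
  intro H hne
  by_contra hcol
  refine hne (H.eq_top_of_forall_adj exists_H7_adj fun u v huv => ?_)
  by_contra hH
  rcases lt_or_gt_of_ne huv.ne with hlt | hlt
  · exact hcol (H7_subgraph_colorable_of_not_adj H huv hlt hH)
  · exact hcol (H7_subgraph_colorable_of_not_adj H huv.symm hlt fun h => hH h.symm)
end

section
/- The graph K_2 + M_7 has a vertex whose neighborhood is not Hamiltonian; namely, there is a vertex u of K_2 + M_7 such that the subgraph induced on the set of neighbors of u contains no Hamiltonian cycle. -/
open SimpleGraph

/-- A Hamiltonian cycle maps a vertex set injectively into any vertex set that contains all of its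
neighbours, by sending each vertex to its successor. -/
theorem SimpleGraph.Walk.IsHamiltonianCycle.card_le_card_of_adj_mem {V : Type*} [DecidableEq V]
    {G : SimpleGraph V} {v : V} {p : G.Walk v v} (hp : p.IsHamiltonianCycle) {S T : Finset V}
    (h : ∀ s ∈ S, ∀ t, G.Adj s t → t ∈ T) : S.card ≤ T.card := by
  have hpos : 0 < p.length := by have := hp.isCycle.three_le_length; omega
  have hex : ∀ s : V, ∃ i < p.length, p.getVert i = s := by
    intro s
    obtain ⟨i, hi, hle⟩ := Walk.mem_support_iff_exists_getVert.mp (hp.mem_support s)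
    rcases hle.lt_or_eq with hlt | rfl
    · exact ⟨i, hlt, hi⟩
    · exact ⟨0, hpos, by simpa using hi⟩
  choose pos hlt hpos_eq using hex
  refine Finset.card_le_card_of_injOn (fun s => p.getVert (pos s + 1)) ?_ ?_
  · intro s hs
    refine h s hs _ ?_
    have := p.adj_getVert_succ (hlt s)
    rwa [hpos_eq] at this
  · intro s _ t _ hst
    have := hp.isCycle.getVert_injOn (x₁ := pos s + 1) (x₂ := pos t + 1)
      ⟨by omega, hlt s⟩ ⟨by omega, hlt t⟩ hst
    rw [← hpos_eq s, ← hpos_eq t, Nat.succ_injective this]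

/-- The vertex `v` of `M_7` is adjacent exactly to `x2`, `x4` and `x6`. -/
theorem M7_adj_six (b : Fin 7) : M7.Adj 6 b ↔ b = 1 ∨ b = 3 ∨ b = 5 := by
  revert b
  simp only [M7, fromRel_adj]
  decide

/-- The neighbours `x2`, `x4`, `x6` of `v` are pairwise nonadjacent in `M_7`. -/
theorem M7_not_adj_of_adj_six {a b : Fin 7} (ha : M7.Adj 6 a) (hb : M7.Adj 6 b) :
    ¬ M7.Adj a b := by
  revert a b
  simp only [M7, fromRel_adj]
  decide

@[simp]
theorem graphJoin_adj_inr_inr {V W : Type*} (G : SimpleGraph V) (H : SimpleGraph W) (a b : W) :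
    (graphJoin G H).Adj (Sum.inr a) (Sum.inr b) ↔ H.Adj a b := by
  simp only [graphJoin, fromRel_adj, ne_eq, Sum.inr.injEq, H.adj_comm b a, or_self,
    and_iff_right_iff_imp]
  exact fun h => h.ne

@[simp]
theorem graphJoin_adj_inr_inl {V W : Type*} (G : SimpleGraph V) (H : SimpleGraph W) (a : W)
    (b : V) : (graphJoin G H).Adj (Sum.inr a) (Sum.inl b) := by
  simp [graphJoin]

/-- `K_2 + M_7` has a vertex `u` whose neighborhood is not Hamiltonian: the subgraph
induced on the set of neighbors of `u` contains no Hamiltonian cycle. -/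
theorem k2_join_m7_has_nonhamiltonian_neighborhood :
    ∃ u : Fin 2 ⊕ Fin 7,
      ¬ ∃ (v : (graphJoin (⊤ : SimpleGraph (Fin 2)) M7).neighborSet u)
          (p : ((graphJoin (⊤ : SimpleGraph (Fin 2)) M7).induce
            ((graphJoin (⊤ : SimpleGraph (Fin 2)) M7).neighborSet u)).Walk v v),
        p.IsHamiltonianCycle := by
  refine ⟨Sum.inr 6, ?_⟩
  rintro ⟨v, p, hp⟩
  let l (a : Fin 2) : (graphJoin (⊤ : SimpleGraph (Fin 2)) M7).neighborSet (Sum.inr 6) :=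
    ⟨Sum.inl a, by simp⟩
  let r (a : Fin 7) (ha : M7.Adj 6 a) :
      (graphJoin (⊤ : SimpleGraph (Fin 2)) M7).neighborSet (Sum.inr 6) :=
    ⟨Sum.inr a, by simpa using ha⟩
  have h1 : M7.Adj 6 1 := by simp [M7_adj_six]
  have h3 : M7.Adj 6 3 := by simp [M7_adj_six]
  have h5 : M7.Adj 6 5 := by simp [M7_adj_six]
  have hle := hp.card_le_card_of_adj_mem
    (S := {r 1 h1, r 3 h3, r 5 h5}) (T := {l 0, l 1}) ?_
  · have hS : ({r 1 h1, r 3 h3, r 5 h5} : Finset _).card = 3 :=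
      Finset.card_eq_three.mpr ⟨_, _, _, by simp [r], by simp [r], by simp [r], rfl⟩
    rw [hS] at hle
    have := hle.trans Finset.card_le_two
    omega
  · rintro s hs ⟨a | b, ht⟩ hst
    · fin_cases a <;> simp [l]
    · exfalso
      have hb : M7.Adj 6 b := by simpa using ht
      simp only [Finset.mem_insert, Finset.mem_singleton] at hs
      rcases hs with rfl | rfl | rfl
      · exact M7_not_adj_of_adj_six h1 hb (by simpa [r] using hst)
      · exact M7_not_adj_of_adj_six h3 hb (by simpa [r] using hst)
      · exact M7_not_adj_of_adj_six h5 hb (by simpa [r] using hst)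
end

section
/- Every 6-critical graph with at most nine vertices either has a subgraph isomorphic to K_6, C_3 + C_5, or K_2 + H_7, or is isomorphic to K_2 + M_7. -/
open SimpleGraph

/-- A graph is `t`-critical if it is not `(t-1)`-colorable but every proper subgraph is
`(t-1)`-colorable. -/
def IsCritical (t : ℕ) {V : Type*} (G : SimpleGraph V) : Prop :=
  ¬ G.Colorable (t - 1) ∧ ∀ H : G.Subgraph, H ≠ ⊤ → H.coe.Colorable (t - 1)


/-- `G` has a subgraph isomorphic to `H`: an injective graph homomorphism `H →g G`. -/
def HasSubgraphIso {W V : Type*} (H : SimpleGraph W) (G : SimpleGraph V) : Prop :=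
  ∃ f : H →g G, Function.Injective f


/-- A graph that is not 2-colorable has a shortest odd closed walk, which is a cycle. -/
lemma exists_odd_cycle_of_not_two_colorable {W : Type*} [Fintype W] {G : SimpleGraph W}
    (hG : ¬ G.Colorable 2) :
    ∃ n, Odd n ∧ n ≠ 1 ∧ n ≤ Fintype.card W ∧ ∃ f : ℕ → W, f n = f 0 ∧
      (∀ i < n, ∀ j < n, f i = f j → i = j) ∧ ∀ i < n, G.Adj (f i) (f (i + 1)) := by
  classical
  rw [two_colorable_iff_forall_loop_even] at hG
  push Not at hG
  have hex : ∃ n, ∃ u, ∃ w : G.Walk u u, Odd w.length ∧ w.length = n := by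
    obtain ⟨u, w, hw⟩ := hG
    exact ⟨_, u, w, by simpa using hw, rfl⟩
  obtain ⟨u, w, hodd, hlen⟩ := Nat.find_spec hex
  have hmin : ∀ (v : W) (p : G.Walk v v), p.length < w.length → Even p.length := by
    intro v p hp
    by_contra hc
    exact Nat.find_min hex (hlen ▸ hp) ⟨v, p, by simpa using hc, rfl⟩
  have hlt : ∀ i j, i < j → j < w.length → w.getVert i ≠ w.getVert j := by
    intro i j hij hj heq
    have h1 := hmin _ ((w.take i).append ((w.drop j).copy heq.symm rfl)) (by
      simp [Walk.take_length, Walk.drop_length]; omega)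
    have hd : ((w.drop i).take (j - i)).length = j - i := by
      simp [Walk.take_length, Walk.drop_length]; omega
    have hend : (w.drop i).getVert (j - i) = w.getVert i := by
      rw [Walk.drop_getVert, heq]; congr 1; omega
    have h2 := hmin _ (((w.drop i).take (j - i)).copy rfl hend) (by
      simp only [Walk.length_copy, hd]; omega)
    rw [Walk.length_copy, hd] at h2
    simp only [Walk.length_append, Walk.length_copy, Walk.take_length, Walk.drop_length] at h1
    rw [min_eq_left (by omega)] at h1
    obtain ⟨a, ha⟩ := h1
    obtain ⟨b, hb⟩ := h2
    obtain ⟨c, hc⟩ := hodd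
    omega
  have hinj : ∀ i < w.length, ∀ j < w.length, w.getVert i = w.getVert j → i = j := by
    intro i hi j hj h
    rcases lt_trichotomy i j with hij | hij | hij
    · exact (hlt i j hij hj h).elim
    · exact hij
    · exact (hlt j i hij hi h.symm).elim
  refine ⟨w.length, hodd, ?_, ?_, w.getVert, by simp, hinj,
    fun i hi => w.adj_getVert_succ hi⟩
  · intro h1
    have := w.adj_getVert_succ (i := 0) (by omega)
    rw [zero_add, ← h1, Walk.getVert_length, Walk.getVert_zero] at this
    exact G.loopless.irrefl _ this
  · have := Fintype.card_le_of_injective (fun i : Fin w.length => w.getVert i)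
      (fun i j h => Fin.ext (hinj i i.2 j j.2 h))
    simpa using this

/-- `G` contains one of the four listed graphs as a subgraph. -/
def ContainsListed {V : Type*} (G : SimpleGraph V) : Prop :=
  HasSubgraphIso (⊤ : SimpleGraph (Fin 6)) G ∨
  HasSubgraphIso (graphJoin (cyc 3) (cyc 5)) G ∨
  HasSubgraphIso (graphJoin (⊤ : SimpleGraph (Fin 2)) H7) G ∨
  HasSubgraphIso (graphJoin (⊤ : SimpleGraph (Fin 2)) M7) G

lemma HasSubgraphIso.of_comap {U V W : Type*} {P : SimpleGraph W} {G : SimpleGraph V} (σ : U → V)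
    (hσ : Function.Injective σ) (h : HasSubgraphIso P (G.comap σ)) : HasSubgraphIso P G := by
  obtain ⟨f, hf⟩ := h
  exact ⟨⟨fun x => σ (f x), fun h => f.map_rel h⟩, hσ.comp hf⟩

lemma ContainsListed.of_comap {U V : Type*} {G : SimpleGraph V} (σ : U → V)
    (hσ : Function.Injective σ) (h : ContainsListed (G.comap σ)) : ContainsListed G := by
  rcases h with h | h | h | h
  · exact .inl (h.of_comap σ hσ)
  · exact .inr (.inl (h.of_comap σ hσ))
  · exact .inr (.inr (.inl (h.of_comap σ hσ)))
  · exact .inr (.inr (.inr (h.of_comap σ hσ)))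

lemma not_colorable_comap {G : SimpleGraph (Fin 9)} (hG : ¬ G.Colorable 5) (σ : Fin 9 → Fin 9)
    (hσ : Function.Injective σ) : ¬ (G.comap σ).Colorable 5 := by
  intro ⟨c⟩
  obtain ⟨τ, hτ⟩ := (Finite.surjective_of_injective hσ).hasRightInverse
  refine hG ⟨Coloring.mk (fun v => c (τ v)) fun {v w} h => c.valid ?_⟩
  rwa [comap_adj, hτ v, hτ w]

/-- Joining the complete graph on two vertices to `P`: an embedding of `P` extends by two
vertices adjacent to everything. -/
lemma hasSubgraphIso_join_two {V W : Type*} {P : SimpleGraph W} {G : SimpleGraph V} {g h : V}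
    (f : W → V) (hf : Function.Injective f) (hP : ∀ x y, P.Adj x y → G.Adj (f x) (f y))
    (hg : ∀ x, G.Adj g (f x)) (hh : ∀ x, G.Adj h (f x)) (hgh : G.Adj g h) :
    HasSubgraphIso (graphJoin (⊤ : SimpleGraph (Fin 2)) P) G := by
  have hgf : ∀ i x, G.Adj (![g, h] i) (f x) := by
    intro i x; fin_cases i
    · exact hg x
    · exact hh x
  have htop : ∀ i j, i ≠ j → G.Adj (![g, h] i) (![g, h] j) := by
    intro i j hij
    fin_cases i <;> fin_cases j
    · exact (hij rfl).elim
    · exact hgh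
    · exact hgh.symm
    · exact (hij rfl).elim
  refine ⟨⟨Sum.elim ![g, h] f, ?_⟩, ?_⟩
  · rintro (a | a) (b | b) ⟨hne, hab⟩
    · exact htop _ _ fun h => hne (by rw [h])
    · exact hgf _ _
    · exact (hgf _ _).symm
    · exact hP _ _ (hab.elim id fun h => h.symm)
  · rintro (a | a) (b | b) hab
    · by_contra hne
      exact (htop a b fun h => hne (by rw [h])).ne hab
    · exact ((hgf a b).ne hab).elim
    · exact ((hgf b a).ne hab.symm).elim
    · exact congrArg _ (hf hab)

lemma hasSubgraphIso_join_cyc_three_five {V : Type*} {G : SimpleGraph V} (u : Fin 3 → V)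
    (w : Fin 5 → V) (hu : ∀ i j, i ≠ j → G.Adj (u i) (u j)) (hw : Function.Injective w)
    (hw' : ∀ i, G.Adj (w i) (w (i + 1))) (huw : ∀ i j, G.Adj (u i) (w j)) :
    HasSubgraphIso (graphJoin (cyc 3) (cyc 5)) G := by
  have hcyc : ∀ a b : Fin 5, a - b = 1 → G.Adj (w a) (w b) := by
    intro a b h
    rw [sub_eq_iff_eq_add'.mp h]
    exact (hw' b).symm
  refine ⟨⟨Sum.elim u w, ?_⟩, ?_⟩
  · rintro (a | a) (b | b) ⟨hne, hab⟩
    · exact hu _ _ fun h => hne (by rw [h])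
    · exact huw _ _
    · exact (huw _ _).symm
    · rcases hab with h | h
      · exact h.2.elim (hcyc a b) fun h => (hcyc b a h).symm
      · exact h.2.elim (fun h => (hcyc b a h).symm) (hcyc a b)
  · rintro (a | a) (b | b) hab
    · by_contra hne
      exact (hu a b fun h => hne (by rw [h])).ne hab
    · exact ((huw a b).ne hab).elim
    · exact ((huw b a).ne hab.symm).elim
    · exact congrArg _ (hw hab)

lemma hasSubgraphIso_top_six {V : Type*} {G : SimpleGraph V} (v : Fin 6 → V)
    (hv : ∀ i j, i < j → G.Adj (v i) (v j)) : HasSubgraphIso (⊤ : SimpleGraph (Fin 6)) G := by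
  have hne : ∀ i j, i ≠ j → G.Adj (v i) (v j) := fun i j h =>
    h.lt_or_gt.elim (hv i j) fun h => (hv j i h).symm
  refine ⟨⟨v, fun h => hne _ _ h⟩, fun i j h => ?_⟩
  by_contra hij
  exact (hne i j hij).ne h

/-- A triangle completely joined to a non-bipartite graph on at most six vertices. -/
lemma containsListed_of_triangle_join {V : Type*} {G : SimpleGraph V} (u : Fin 3 → V)
    (hu : ∀ i j, i ≠ j → G.Adj (u i) (u j)) (Q : Finset V) (hcard : Q.card ≤ 6)
    (huQ : ∀ i, ∀ q ∈ Q, G.Adj (u i) q) (hQ : ¬ (G.induce (Q : Set V)).Colorable 2) :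
    ContainsListed G := by
  obtain ⟨n, hodd, hn1, hn, f, hf0, hinj, hadj⟩ := exists_odd_cycle_of_not_two_colorable hQ
  have hn6 : n ≤ 6 := hn.trans (by simpa using hcard)
  replace hadj : ∀ i < n, G.Adj (f i) (f (i + 1)) := hadj
  have hn35 : n = 3 ∨ n = 5 := by
    obtain ⟨k, hk⟩ := hodd
    omega
  rcases hn35 with rfl | rfl
  · refine .inl (hasSubgraphIso_top_six ![u 0, u 1, u 2, f 0, f 1, f 2] ?_)
    have h1 := hadj 0 (by norm_num)
    have h2 := hadj 1 (by norm_num)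
    have h3 := (hadj 2 (by norm_num)).symm
    rw [show f (2 + 1) = f 0 from hf0] at h3
    have hq : ∀ i j, G.Adj (u i) (f j) := fun i j => huQ i _ (f j).2
    have h01 := hu 0 1 (by decide)
    have h02 := hu 0 2 (by decide)
    have h12 := hu 1 2 (by decide)
    intro i j hij
    fin_cases i <;> fin_cases j <;> first
      | exact absurd hij (by decide)
      | assumption
      | exact hq _ _
  · refine .inr (.inl (hasSubgraphIso_join_cyc_three_five u (fun i => f i) hu ?_ ?_ ?_))
    · intro i j hij
      exact Fin.ext (hinj i i.2 j j.2 (Subtype.ext hij))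
    · intro i
      have h := hadj i i.2
      fin_cases i <;> first | exact h | (rw [hf0] at h; exact h)
    · exact fun i j => huQ i _ (f j).2

section FinNine

variable {G : SimpleGraph (Fin 9)}

lemma exists_adj_of_not_colorable (hG : ¬ G.Colorable 5) (v : Fin 9 → Fin 9)
    (hv : Function.Injective v) (c : Fin 9 → Fin 5) :
    ∃ i j, i < j ∧ c i = c j ∧ G.Adj (v i) (v j) := by
  by_contra! hc
  refine not_colorable_comap hG v hv ⟨Coloring.mk c fun {i j} h hij => ?_⟩
  rcases h.ne.lt_or_gt with h' | h'
  · exact hc i j h' hij h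
  · exact hc j i h' hij.symm h.symm

lemma adj_of_four_pairs (hG : ¬ G.Colorable 5) (a b c d e f g h i : Fin 9)
    (hv : [a, b, c, d, e, f, g, h, i].Nodup) :
    G.Adj a b ∨ G.Adj c d ∨ G.Adj e f ∨ G.Adj g h := by
  obtain ⟨k, l, hkl, hc, hadj⟩ := exists_adj_of_not_colorable hG ![a, b, c, d, e, f, g, h, i]
    (List.nodup_ofFn.mp hv) ![(0 : Fin 5), 0, 1, 1, 2, 2, 3, 3, 4]
  have : ∀ k l : Fin 9, k < l →
      ![(0 : Fin 5), 0, 1, 1, 2, 2, 3, 3, 4] k = ![(0 : Fin 5), 0, 1, 1, 2, 2, 3, 3, 4] l →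
      k = 0 ∧ l = 1 ∨ k = 2 ∧ l = 3 ∨ k = 4 ∧ l = 5 ∨ k = 6 ∧ l = 7 := by decide
  rcases this k l hkl hc with ⟨rfl, rfl⟩ | ⟨rfl, rfl⟩ | ⟨rfl, rfl⟩ | ⟨rfl, rfl⟩ <;>
    simp_all

lemma adj_of_triple_two_pairs (hG : ¬ G.Colorable 5) (a b c d e f g h i : Fin 9)
    (hv : [a, b, c, d, e, f, g, h, i].Nodup) :
    G.Adj a b ∨ G.Adj a c ∨ G.Adj b c ∨ G.Adj d e ∨ G.Adj f g := by
  obtain ⟨k, l, hkl, hc, hadj⟩ := exists_adj_of_not_colorable hG ![a, b, c, d, e, f, g, h, i]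
    (List.nodup_ofFn.mp hv) ![(0 : Fin 5), 0, 0, 1, 1, 2, 2, 3, 4]
  have : ∀ k l : Fin 9, k < l →
      ![(0 : Fin 5), 0, 0, 1, 1, 2, 2, 3, 4] k = ![(0 : Fin 5), 0, 0, 1, 1, 2, 2, 3, 4] l →
      k = 0 ∧ l = 1 ∨ k = 0 ∧ l = 2 ∨ k = 1 ∧ l = 2 ∨ k = 3 ∧ l = 4 ∨ k = 5 ∧ l = 6 := by decide
  rcases this k l hkl hc with ⟨rfl, rfl⟩ | ⟨rfl, rfl⟩ | ⟨rfl, rfl⟩ | ⟨rfl, rfl⟩ | ⟨rfl, rfl⟩ <;>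
    simp_all

lemma adj_of_two_triples (hG : ¬ G.Colorable 5) (a b c d e f g h i : Fin 9)
    (hv : [a, b, c, d, e, f, g, h, i].Nodup) :
    G.Adj a b ∨ G.Adj a c ∨ G.Adj b c ∨ G.Adj d e ∨ G.Adj d f ∨ G.Adj e f := by
  obtain ⟨k, l, hkl, hc, hadj⟩ := exists_adj_of_not_colorable hG ![a, b, c, d, e, f, g, h, i]
    (List.nodup_ofFn.mp hv) ![(0 : Fin 5), 0, 0, 1, 1, 1, 2, 3, 4]
  have : ∀ k l : Fin 9, k < l →
      ![(0 : Fin 5), 0, 0, 1, 1, 1, 2, 3, 4] k = ![(0 : Fin 5), 0, 0, 1, 1, 1, 2, 3, 4] l →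
      k = 0 ∧ l = 1 ∨ k = 0 ∧ l = 2 ∨ k = 1 ∧ l = 2 ∨ k = 3 ∧ l = 4 ∨ k = 3 ∧ l = 5 ∨
      k = 4 ∧ l = 5 := by decide
  rcases this k l hkl hc with ⟨rfl, rfl⟩ | ⟨rfl, rfl⟩ | ⟨rfl, rfl⟩ | ⟨rfl, rfl⟩ | ⟨rfl, rfl⟩ |
      ⟨rfl, rfl⟩ <;>
    simp_all

lemma adj_of_quintuple (hG : ¬ G.Colorable 5) (a b c d e f g h i : Fin 9)
    (hv : [a, b, c, d, e, f, g, h, i].Nodup) :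
    G.Adj a b ∨ G.Adj a c ∨ G.Adj a d ∨ G.Adj a e ∨ G.Adj b c ∨ G.Adj b d ∨ G.Adj b e ∨ G.Adj c d ∨
    G.Adj c e ∨ G.Adj d e := by
  obtain ⟨k, l, hkl, hc, hadj⟩ := exists_adj_of_not_colorable hG ![a, b, c, d, e, f, g, h, i]
    (List.nodup_ofFn.mp hv) ![(0 : Fin 5), 0, 0, 0, 0, 1, 2, 3, 4]
  have : ∀ k l : Fin 9, k < l →
      ![(0 : Fin 5), 0, 0, 0, 0, 1, 2, 3, 4] k = ![(0 : Fin 5), 0, 0, 0, 0, 1, 2, 3, 4] l →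
      k = 0 ∧ l = 1 ∨ k = 0 ∧ l = 2 ∨ k = 0 ∧ l = 3 ∨ k = 0 ∧ l = 4 ∨ k = 1 ∧ l = 2 ∨
      k = 1 ∧ l = 3 ∨ k = 1 ∧ l = 4 ∨ k = 2 ∧ l = 3 ∨ k = 2 ∧ l = 4 ∨ k = 3 ∧ l = 4 := by decide
  rcases this k l hkl hc with ⟨rfl, rfl⟩ | ⟨rfl, rfl⟩ | ⟨rfl, rfl⟩ | ⟨rfl, rfl⟩ | ⟨rfl, rfl⟩ |
      ⟨rfl, rfl⟩ | ⟨rfl, rfl⟩ | ⟨rfl, rfl⟩ | ⟨rfl, rfl⟩ | ⟨rfl, rfl⟩ <;>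
    simp_all

/-- The complement of `G` misses the edges of `K₂ + H₇`. -/
lemma containsListed_of_H7 (h7 : ∀ i, i ≠ 7 → G.Adj 7 i) (h8 : ∀ i, i ≠ 8 → G.Adj 8 i)
    (h02 : G.Adj 0 2) (h24 : G.Adj 2 4) (h46 : G.Adj 4 6) (h16 : G.Adj 1 6) (h13 : G.Adj 1 3)
    (h35 : G.Adj 3 5) (h05 : G.Adj 0 5) (h36 : G.Adj 3 6) (h04 : G.Adj 0 4) (h15 : G.Adj 1 5)
    (h26 : G.Adj 2 6) : ContainsListed G := by
  refine .inr (.inr (.inl (hasSubgraphIso_join_two (g := 7) (h := 8) ![6, 1, 3, 5, 2, 4, 0]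
    (by decide) ?_ (fun x => h7 _ (by revert x; decide)) (fun x => h8 _ (by revert x; decide))
    (h7 8 (by decide)))))
  have key : ∀ x y : Fin 7, (x.val, y.val) ∈ [(0,1), (0,2), (1,2), (1,3), (2,3), (0,4), (0,5),
      (4,5), (4,6), (5,6), (3,6)] →
      G.Adj (![(6 : Fin 9), 1, 3, 5, 2, 4, 0] x) (![(6 : Fin 9), 1, 3, 5, 2, 4, 0] y) := by
    intro x y hxy
    fin_cases x <;> fin_cases y <;> first
      | exact absurd hxy (by decide)
      | assumption
      | (refine G.adj_symm ?_; assumption)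
  rintro x y ⟨-, h | h⟩
  · exact key x y h
  · exact (key y x h).symm

lemma containsListed_of_M7 (h7 : ∀ i, i ≠ 7 → G.Adj 7 i) (h8 : ∀ i, i ≠ 8 → G.Adj 8 i)
    (h02 : G.Adj 0 2) (h13 : G.Adj 1 3) (h24 : G.Adj 2 4) (h03 : G.Adj 0 3) (h14 : G.Adj 1 4)
    (h15 : G.Adj 1 5) (h25 : G.Adj 2 5) (h35 : G.Adj 3 5) (h45 : G.Adj 4 5)
    (h06 : G.Adj 0 6) (h16 : G.Adj 1 6) (h46 : G.Adj 4 6) : ContainsListed G := by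
  refine .inr (.inr (.inr (hasSubgraphIso_join_two (g := 7) (h := 8) ![1, 6, 4, 2, 5, 3, 0]
    (by decide) ?_ (fun x => h7 _ (by revert x; decide)) (fun x => h8 _ (by revert x; decide))
    (h7 8 (by decide)))))
  have key : ∀ x y : Fin 7, (x.val, y.val) ∈ [(0,1), (1,2), (2,3), (3,4), (4,5), (5,0), (0,2),
      (2,4), (4,0), (6,1), (6,3), (6,5)] →
      G.Adj (![(1 : Fin 9), 6, 4, 2, 5, 3, 0] x) (![(1 : Fin 9), 6, 4, 2, 5, 3, 0] y) := by
    intro x y hxy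
    fin_cases x <;> fin_cases y <;> first
      | exact absurd hxy (by decide)
      | assumption
      | (refine G.adj_symm ?_; assumption)
  rintro x y ⟨-, h | h⟩
  · exact key x y h
  · exact (key y x h).symm

/-- The complement of `G` has two isolated vertices and a Hamiltonian cycle on the others. -/
lemma containsListed_of_seven_cycle (hG : ¬ G.Colorable 5) (h7 : ∀ i, i ≠ 7 → G.Adj 7 i)
    (h8 : ∀ i, i ≠ 8 → G.Adj 8 i) (h01 : ¬ G.Adj 0 1) (h12 : ¬ G.Adj 1 2) (h23 : ¬ G.Adj 2 3)
    (h34 : ¬ G.Adj 3 4) (h45 : ¬ G.Adj 4 5) (h56 : ¬ G.Adj 5 6) (h06 : ¬ G.Adj 0 6) :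
    ContainsListed G := by
  have h02 : G.Adj 0 2 := by
    have := adj_of_triple_two_pairs hG 0 1 2 3 4 5 6 7 8 (by decide); tauto
  have h13 : G.Adj 1 3 := by
    have := adj_of_triple_two_pairs hG 1 2 3 4 5 0 6 7 8 (by decide); tauto
  have h24 : G.Adj 2 4 := by
    have := adj_of_triple_two_pairs hG 2 3 4 0 1 5 6 7 8 (by decide); tauto
  have h35 : G.Adj 3 5 := by
    have := adj_of_triple_two_pairs hG 3 4 5 1 2 0 6 7 8 (by decide); tauto
  have h46 : G.Adj 4 6 := by
    have := adj_of_triple_two_pairs hG 4 5 6 0 1 2 3 7 8 (by decide); tauto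
  have h05 : G.Adj 0 5 := by
    have := adj_of_triple_two_pairs hG 0 6 5 1 2 3 4 7 8 (by decide)
    rw [G.adj_comm 6 5] at this; tauto
  have h16 : G.Adj 1 6 := by
    have := adj_of_triple_two_pairs hG 0 1 6 2 3 4 5 7 8 (by decide); tauto
  have t0 : G.Adj 0 3 ∨ G.Adj 3 6 := by
    have := adj_of_triple_two_pairs hG 0 3 6 1 2 4 5 7 8 (by decide); tauto
  have t1 : G.Adj 1 4 ∨ G.Adj 0 4 := by
    have := adj_of_triple_two_pairs hG 0 1 4 2 3 5 6 7 8 (by decide); tauto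
  have t2 : G.Adj 2 5 ∨ G.Adj 1 5 := by
    have := adj_of_triple_two_pairs hG 1 2 5 3 4 0 6 7 8 (by decide); tauto
  have t3 : G.Adj 3 6 ∨ G.Adj 2 6 := by
    have := adj_of_triple_two_pairs hG 2 3 6 0 1 4 5 7 8 (by decide); tauto
  have t4 : G.Adj 0 4 ∨ G.Adj 0 3 := by
    have := adj_of_triple_two_pairs hG 0 3 4 1 2 5 6 7 8 (by decide); tauto
  have t5 : G.Adj 1 5 ∨ G.Adj 1 4 := by
    have := adj_of_triple_two_pairs hG 1 4 5 2 3 0 6 7 8 (by decide); tauto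
  have t6 : G.Adj 2 6 ∨ G.Adj 2 5 := by
    have := adj_of_triple_two_pairs hG 2 5 6 0 1 3 4 7 8 (by decide); tauto
  have key : (G.Adj 3 6 ∧ G.Adj 0 4 ∧ G.Adj 1 5 ∧ G.Adj 2 6) ∨
      (G.Adj 0 4 ∧ G.Adj 1 5 ∧ G.Adj 2 6 ∧ G.Adj 0 3) ∨
      (G.Adj 1 5 ∧ G.Adj 2 6 ∧ G.Adj 0 3 ∧ G.Adj 1 4) ∨
      (G.Adj 2 6 ∧ G.Adj 0 3 ∧ G.Adj 1 4 ∧ G.Adj 2 5) ∨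
      (G.Adj 0 3 ∧ G.Adj 1 4 ∧ G.Adj 2 5 ∧ G.Adj 3 6) ∨
      (G.Adj 1 4 ∧ G.Adj 2 5 ∧ G.Adj 3 6 ∧ G.Adj 0 4) ∨
      (G.Adj 2 5 ∧ G.Adj 3 6 ∧ G.Adj 0 4 ∧ G.Adj 1 5) := by
    clear h01 h12 h23 h34 h45 h56 h06 h02 h13 h24 h35 h46 h05 h16
    grind
  rcases key with ⟨_, _, _, _⟩ | ⟨_, _, _, _⟩ | ⟨_, _, _, _⟩ | ⟨_, _, _, _⟩ | ⟨_, _, _, _⟩ |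
      ⟨_, _, _, _⟩ | ⟨_, _, _, _⟩
  · exact containsListed_of_H7 h7 h8 h02 h24 h46 h16 h13 h35 h05 ‹_› ‹_› ‹_› ‹_›
  · refine .of_comap ![1, 2, 3, 4, 5, 6, 0, 7, 8] (by decide) (containsListed_of_H7
      (fun i hi => h7 _ (by revert i; decide)) (fun i hi => h8 _ (by revert i; decide))
      ?_ ?_ ?_ ?_ ?_ ?_ ?_ ?_ ?_ ?_ ?_) <;>
      first | assumption | (refine G.adj_symm ?_; assumption)
  · refine .of_comap ![2, 3, 4, 5, 6, 0, 1, 7, 8] (by decide) (containsListed_of_H7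
      (fun i hi => h7 _ (by revert i; decide)) (fun i hi => h8 _ (by revert i; decide))
      ?_ ?_ ?_ ?_ ?_ ?_ ?_ ?_ ?_ ?_ ?_) <;>
      first | assumption | (refine G.adj_symm ?_; assumption)
  · refine .of_comap ![3, 4, 5, 6, 0, 1, 2, 7, 8] (by decide) (containsListed_of_H7
      (fun i hi => h7 _ (by revert i; decide)) (fun i hi => h8 _ (by revert i; decide))
      ?_ ?_ ?_ ?_ ?_ ?_ ?_ ?_ ?_ ?_ ?_) <;>
      first | assumption | (refine G.adj_symm ?_; assumption)
  · refine .of_comap ![4, 5, 6, 0, 1, 2, 3, 7, 8] (by decide) (containsListed_of_H7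
      (fun i hi => h7 _ (by revert i; decide)) (fun i hi => h8 _ (by revert i; decide))
      ?_ ?_ ?_ ?_ ?_ ?_ ?_ ?_ ?_ ?_ ?_) <;>
      first | assumption | (refine G.adj_symm ?_; assumption)
  · refine .of_comap ![5, 6, 0, 1, 2, 3, 4, 7, 8] (by decide) (containsListed_of_H7
      (fun i hi => h7 _ (by revert i; decide)) (fun i hi => h8 _ (by revert i; decide))
      ?_ ?_ ?_ ?_ ?_ ?_ ?_ ?_ ?_ ?_ ?_) <;>
      first | assumption | (refine G.adj_symm ?_; assumption)
  · refine .of_comap ![6, 0, 1, 2, 3, 4, 5, 7, 8] (by decide) (containsListed_of_H7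
      (fun i hi => h7 _ (by revert i; decide)) (fun i hi => h8 _ (by revert i; decide))
      ?_ ?_ ?_ ?_ ?_ ?_ ?_ ?_ ?_ ?_ ?_) <;>
      first | assumption | (refine G.adj_symm ?_; assumption)


lemma containsListed_of_six (v : Fin 6 → Fin 9) (hv : ∀ i j, i < j → G.Adj (v i) (v j)) :
    ContainsListed G := .inl (hasSubgraphIso_top_six v hv)

lemma adj_comap_of_fixed {σ : Fin 9 → Fin 9} (hσ : Function.Injective σ) {k : Fin 9}
    (hk : σ k = k) (h : ∀ i, i ≠ k → G.Adj k i) : ∀ i, i ≠ k → (G.comap σ).Adj k i := by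
  intro i hi
  rw [comap_adj, hk]
  exact h _ fun h => hi (hσ (h.trans hk.symm))

/-- The complement of `G` has two isolated vertices `7`, `8`, a 5-cycle and a disjoint edge `56`
which is attached to the cycle at `0`. -/
lemma containsListed_of_attached_five_cycle (hG : ¬ G.Colorable 5)
    (h7 : ∀ i, i ≠ 7 → G.Adj 7 i) (h8 : ∀ i, i ≠ 8 → G.Adj 8 i) (h01 : ¬ G.Adj 0 1)
    (h12 : ¬ G.Adj 1 2) (h23 : ¬ G.Adj 2 3) (h34 : ¬ G.Adj 3 4) (h04 : ¬ G.Adj 0 4)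
    (h56 : ¬ G.Adj 5 6) (h05 : ¬ G.Adj 0 5) : ContainsListed G := by
  have h02 : G.Adj 0 2 := by
    have := adj_of_triple_two_pairs hG 0 1 2 3 4 5 6 7 8 (by decide); tauto
  have h13 : G.Adj 1 3 := by
    have := adj_of_triple_two_pairs hG 1 2 3 0 4 5 6 7 8 (by decide); tauto
  have h24 : G.Adj 2 4 := by
    have := adj_of_triple_two_pairs hG 2 3 4 0 1 5 6 7 8 (by decide); tauto
  have h03 : G.Adj 0 3 := by
    have := adj_of_triple_two_pairs hG 0 3 4 1 2 5 6 7 8 (by decide); tauto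
  have h14 : G.Adj 1 4 := by
    have := adj_of_triple_two_pairs hG 0 1 4 2 3 5 6 7 8 (by decide); tauto
  have h06 : G.Adj 0 6 := by
    have := adj_of_triple_two_pairs hG 0 5 6 1 2 3 4 7 8 (by decide); tauto
  have seven (σ : Fin 9 → Fin 9) (hσ : Function.Injective σ) (h7' : σ 7 = 7) (h8' : σ 8 = 8) :=
    fun a b c d e f g => ContainsListed.of_comap σ hσ
      (containsListed_of_seven_cycle (not_colorable_comap hG σ hσ)
        (adj_comap_of_fixed hσ h7' h7) (adj_comap_of_fixed hσ h8' h8) a b c d e f g)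
  simp only [comap_adj] at seven
  by_cases h16 : G.Adj 1 6; swap
  · refine seven ![5, 0, 4, 3, 2, 1, 6, 7, 8] (by decide) rfl rfl ?_ ?_ ?_ ?_ ?_ ?_ ?_ <;>
      first | assumption | (refine mt G.adj_symm ?_; assumption)
  by_cases h46 : G.Adj 4 6; swap
  · refine seven ![5, 0, 1, 2, 3, 4, 6, 7, 8] (by decide) rfl rfl ?_ ?_ ?_ ?_ ?_ ?_ ?_ <;>
      first | assumption | (refine mt G.adj_symm ?_; assumption)
  by_cases h26 : G.Adj 2 6
  · by_cases h36 : G.Adj 3 6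
    · refine .inr (.inl (hasSubgraphIso_join_cyc_three_five ![6, 7, 8] ![0, 2, 4, 1, 3]
        ?_ (by decide) ?_ ?_))
      · intro i j hij
        fin_cases i <;> fin_cases j <;> first
          | exact absurd rfl hij
          | exact h7 _ (by decide)
          | exact h8 _ (by decide)
          | exact (h7 6 (by decide)).symm
          | exact (h8 6 (by decide)).symm
      · intro i
        fin_cases i <;> first | assumption | (refine G.adj_symm ?_; assumption)
      · intro i j
        fin_cases i
        · fin_cases j <;> (refine G.adj_symm ?_; assumption)
        · exact h7 _ (by revert j; decide)
        · exact h8 _ (by revert j; decide)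
    · by_cases h45 : G.Adj 4 5; swap
      · refine seven ![5, 4, 0, 1, 2, 3, 6, 7, 8] (by decide) rfl rfl ?_ ?_ ?_ ?_ ?_ ?_ ?_ <;>
          first | assumption | (refine mt G.adj_symm ?_; assumption)
      by_cases h25 : G.Adj 2 5; swap
      · refine seven ![5, 2, 1, 0, 4, 3, 6, 7, 8] (by decide) rfl rfl ?_ ?_ ?_ ?_ ?_ ?_ ?_ <;>
          first | assumption | (refine mt G.adj_symm ?_; assumption)
      have h35 : G.Adj 3 5 := by
        have := adj_of_triple_two_pairs hG 3 5 6 1 2 0 4 7 8 (by decide); tauto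
      refine .of_comap ![3, 4, 0, 1, 2, 6, 5, 7, 8] (by decide) (containsListed_of_M7
        (fun i hi => h7 _ (by revert i; decide)) (fun i hi => h8 _ (by revert i; decide))
        ?_ ?_ ?_ ?_ ?_ ?_ ?_ ?_ ?_ ?_ ?_ ?_) <;>
        first | assumption | (refine G.adj_symm ?_; assumption)
  · have h25 : G.Adj 2 5 := by
      have := adj_of_triple_two_pairs hG 2 5 6 0 1 3 4 7 8 (by decide); tauto
    by_cases h15 : G.Adj 1 5; swap
    · refine seven ![5, 1, 0, 4, 3, 2, 6, 7, 8] (by decide) rfl rfl ?_ ?_ ?_ ?_ ?_ ?_ ?_ <;>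
        first | assumption | (refine mt G.adj_symm ?_; assumption)
    by_cases h35 : G.Adj 3 5; swap
    · refine seven ![5, 3, 4, 0, 1, 2, 6, 7, 8] (by decide) rfl rfl ?_ ?_ ?_ ?_ ?_ ?_ ?_ <;>
        first | assumption | (refine mt G.adj_symm ?_; assumption)
    by_cases h36 : G.Adj 3 6
    · refine .of_comap ![2, 3, 4, 0, 1, 6, 5, 7, 8] (by decide) (containsListed_of_M7
        (fun i hi => h7 _ (by revert i; decide)) (fun i hi => h8 _ (by revert i; decide))
        ?_ ?_ ?_ ?_ ?_ ?_ ?_ ?_ ?_ ?_ ?_ ?_) <;>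
        first | assumption | (refine G.adj_symm ?_; assumption)
    · by_cases h45 : G.Adj 4 5; swap
      · refine seven ![5, 4, 0, 1, 2, 3, 6, 7, 8] (by decide) rfl rfl ?_ ?_ ?_ ?_ ?_ ?_ ?_ <;>
          first | assumption | (refine mt G.adj_symm ?_; assumption)
      exact containsListed_of_M7 h7 h8 h02 h13 h24 h03 h14 h15 h25 h35 h45 h06 h16 h46

lemma containsListed_of_five_cycle (hG : ¬ G.Colorable 5)
    (h7 : ∀ i, i ≠ 7 → G.Adj 7 i) (h8 : ∀ i, i ≠ 8 → G.Adj 8 i) (h01 : ¬ G.Adj 0 1)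
    (h12 : ¬ G.Adj 1 2) (h23 : ¬ G.Adj 2 3) (h34 : ¬ G.Adj 3 4) (h04 : ¬ G.Adj 0 4)
    (h56 : ¬ G.Adj 5 6) : ContainsListed G := by
  have rot (σ : Fin 9 → Fin 9) (hσ : Function.Injective σ) (h7' : σ 7 = 7) (h8' : σ 8 = 8) :=
    fun a b c d e f g => ContainsListed.of_comap σ hσ
      (containsListed_of_attached_five_cycle (not_colorable_comap hG σ hσ)
        (adj_comap_of_fixed hσ h7' h7) (adj_comap_of_fixed hσ h8' h8) a b c d e f g)
  simp only [comap_adj] at rot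
  have h10 := mt G.adj_symm h01
  have h21 := mt G.adj_symm h12
  have h32 := mt G.adj_symm h23
  have h43 := mt G.adj_symm h34
  have h40 := mt G.adj_symm h04
  by_cases h05 : G.Adj 0 5; swap
  · exact rot ![0, 1, 2, 3, 4, 5, 6, 7, 8] (by decide) rfl rfl h01 h12 h23 h34 h04 h56 h05
  by_cases h15 : G.Adj 1 5; swap
  · exact rot ![1, 2, 3, 4, 0, 5, 6, 7, 8] (by decide) rfl rfl h12 h23 h34 h40 h10 h56 h15
  by_cases h25 : G.Adj 2 5; swap
  · exact rot ![2, 3, 4, 0, 1, 5, 6, 7, 8] (by decide) rfl rfl h23 h34 h40 h01 h21 h56 h25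
  by_cases h35 : G.Adj 3 5; swap
  · exact rot ![3, 4, 0, 1, 2, 5, 6, 7, 8] (by decide) rfl rfl h34 h40 h01 h12 h32 h56 h35
  by_cases h45 : G.Adj 4 5; swap
  · exact rot ![4, 0, 1, 2, 3, 5, 6, 7, 8] (by decide) rfl rfl h40 h01 h12 h23 h43 h56 h45
  have h02 : G.Adj 0 2 := by
    have := adj_of_triple_two_pairs hG 0 1 2 3 4 5 6 7 8 (by decide); tauto
  have h13 : G.Adj 1 3 := by
    have := adj_of_triple_two_pairs hG 1 2 3 0 4 5 6 7 8 (by decide); tauto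
  have h24 : G.Adj 2 4 := by
    have := adj_of_triple_two_pairs hG 2 3 4 0 1 5 6 7 8 (by decide); tauto
  have h03 : G.Adj 0 3 := by
    have := adj_of_triple_two_pairs hG 0 3 4 1 2 5 6 7 8 (by decide); tauto
  have h14 : G.Adj 1 4 := by
    have := adj_of_triple_two_pairs hG 0 1 4 2 3 5 6 7 8 (by decide); tauto
  refine .inr (.inl (hasSubgraphIso_join_cyc_three_five ![5, 7, 8] ![0, 2, 4, 1, 3]
    ?_ (by decide) ?_ ?_))
  · intro i j hij
    fin_cases i <;> fin_cases j <;> first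
      | exact absurd rfl hij
      | exact h7 _ (by decide)
      | exact h8 _ (by decide)
      | exact (h7 5 (by decide)).symm
      | exact (h8 5 (by decide)).symm
  · intro i
    fin_cases i <;> first | assumption | (refine G.adj_symm ?_; assumption)
  · intro i j
    fin_cases i
    · fin_cases j <;> (refine G.adj_symm ?_; assumption)
    · exact h7 _ (by revert j; decide)
    · exact h8 _ (by revert j; decide)

variable (G) in
/-- The vertex `v` is adjacent to each of the last three vertices. -/
abbrev AdjLastThree (v : Fin 9) : Prop := G.Adj v 6 ∧ G.Adj v 7 ∧ G.Adj v 8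

/-- A vertex of the matching edge `45` has a neighbour in the complement among `7`, `8`. -/
lemma containsListed_of_pendant (hG : ¬ G.Colorable 5) (h01 : ¬ G.Adj 0 1)
    (h23 : ¬ G.Adj 2 3) (h45 : ¬ G.Adj 4 5) (h13 : ¬ G.Adj 1 3) (h78 : G.Adj 7 8)
    (h1 : AdjLastThree G 1) (h3 : AdjLastThree G 3) (h5 : AdjLastThree G 5)
    (h06 : ¬ G.Adj 0 6) (h26 : ¬ G.Adj 2 6) (h07 : G.Adj 0 7) (h08 : G.Adj 0 8)
    (h27 : G.Adj 2 7) (h28 : G.Adj 2 8) (h47 : ¬ G.Adj 4 7) : ContainsListed G := by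
  have h15 : G.Adj 1 5 := by
    have := adj_of_four_pairs hG 0 6 1 5 4 7 2 3 8 (by decide); tauto
  have h35 : G.Adj 3 5 := by
    have := adj_of_four_pairs hG 2 6 3 5 4 7 0 1 8 (by decide); tauto
  have h05 : G.Adj 0 5 := by
    have := adj_of_four_pairs hG 2 6 0 5 4 7 1 3 8 (by decide); tauto
  have h25 : G.Adj 2 5 := by
    have := adj_of_four_pairs hG 0 6 2 5 4 7 1 3 8 (by decide); tauto
  have h03 : G.Adj 0 3 := by
    have := adj_of_triple_two_pairs hG 0 1 3 2 6 4 5 7 8 (by decide); tauto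
  have h12 : G.Adj 1 2 := by
    have := adj_of_triple_two_pairs hG 1 2 3 0 6 4 5 7 8 (by decide); tauto
  have h02 : G.Adj 0 2 := by
    have := adj_of_triple_two_pairs hG 0 2 6 1 3 4 5 7 8 (by decide); tauto
  obtain ⟨h16, h17, h18⟩ := h1
  obtain ⟨h36, h37, h38⟩ := h3
  obtain ⟨h56, h57, h58⟩ := h5
  have h67 : G.Adj 6 7 := by
    have := adj_of_four_pairs hG 0 1 2 3 4 5 6 7 8 (by decide); tauto
  have h68 : G.Adj 6 8 := by
    have := adj_of_four_pairs hG 0 1 2 3 4 5 6 8 7 (by decide); tauto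
  refine .inr (.inl (hasSubgraphIso_join_cyc_three_five ![5, 7, 8] ![6, 1, 2, 0, 3]
    ?_ (by decide) ?_ ?_))
  · intro i j hij
    fin_cases i <;> fin_cases j <;> first
      | exact absurd rfl hij
      | assumption
      | (refine G.adj_symm ?_; assumption)
  · intro i
    fin_cases i <;> first | assumption | (refine G.adj_symm ?_; assumption)
  · intro i j
    fin_cases i <;> fin_cases j <;> first | assumption | (refine G.adj_symm ?_; assumption)

lemma containsListed_of_linked_at_six (hG : ¬ G.Colorable 5) (h01 : ¬ G.Adj 0 1)
    (h23 : ¬ G.Adj 2 3) (h45 : ¬ G.Adj 4 5) (h13 : ¬ G.Adj 1 3) (h1 : AdjLastThree G 1)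
    (h3 : AdjLastThree G 3) (h5 : AdjLastThree G 5) (h06 : ¬ G.Adj 0 6)
    (h2 : ¬ AdjLastThree G 2) : ContainsListed G := by
  have h67 : G.Adj 6 7 := by
    have := adj_of_four_pairs hG 0 1 2 3 4 5 6 7 8 (by decide); tauto
  have h68 : G.Adj 6 8 := by
    have := adj_of_four_pairs hG 0 1 2 3 4 5 6 8 7 (by decide); tauto
  have h78 : G.Adj 7 8 := by
    have := adj_of_four_pairs hG 0 1 2 3 4 5 7 8 6 (by decide); tauto
  have h27 : G.Adj 2 7 := by
    have := adj_of_four_pairs hG 0 6 1 3 2 7 4 5 8 (by decide); tauto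
  have h28 : G.Adj 2 8 := by
    have := adj_of_four_pairs hG 0 6 1 3 2 8 4 5 7 (by decide); tauto
  have h26 : ¬ G.Adj 2 6 := fun h => h2 ⟨h, h27, h28⟩
  have h07 : G.Adj 0 7 := by
    have := adj_of_four_pairs hG 0 7 1 3 2 6 4 5 8 (by decide); tauto
  have h08 : G.Adj 0 8 := by
    have := adj_of_four_pairs hG 0 8 1 3 2 6 4 5 7 (by decide); tauto
  by_cases h47 : G.Adj 4 7; swap
  · exact containsListed_of_pendant hG h01 h23 h45 h13 h78 h1 h3 h5 h06 h26 h07 h08 h27 h28 h47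
  by_cases h48 : G.Adj 4 8; swap
  · exact .of_comap ![0, 1, 2, 3, 4, 5, 6, 8, 7] (by decide) (containsListed_of_pendant
      (not_colorable_comap hG _ (by decide)) h01 h23 h45 h13 h78.symm
      ⟨h1.1, h1.2.2, h1.2.1⟩ ⟨h3.1, h3.2.2, h3.2.1⟩ ⟨h5.1, h5.2.2, h5.2.1⟩ h06 h26 h08 h07 h28
      h27 h48)
  obtain ⟨-, h17, h18⟩ := h1
  obtain ⟨-, h37, h38⟩ := h3
  obtain ⟨-, h57, h58⟩ := h5
  have h7 : ∀ i, i ≠ 7 → G.Adj 7 i := by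
    intro i hi
    fin_cases i <;> first
      | exact absurd rfl hi
      | assumption
      | (refine G.adj_symm ?_; assumption)
  have h8 : ∀ i, i ≠ 8 → G.Adj 8 i := by
    intro i hi
    fin_cases i <;> first
      | exact absurd rfl hi
      | assumption
      | (refine G.adj_symm ?_; assumption)
  exact .of_comap ![6, 0, 1, 3, 2, 4, 5, 7, 8] (by decide) (containsListed_of_five_cycle
    (not_colorable_comap hG _ (by decide)) (adj_comap_of_fixed (by decide) rfl h7)
    (adj_comap_of_fixed (by decide) rfl h8) (mt G.adj_symm h06) h01 h13 (mt G.adj_symm h23)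
    (mt G.adj_symm h26) h45)

lemma containsListed_of_linked (hG : ¬ G.Colorable 5) (h01 : ¬ G.Adj 0 1)
    (h23 : ¬ G.Adj 2 3) (h45 : ¬ G.Adj 4 5) (h13 : ¬ G.Adj 1 3) (h1 : AdjLastThree G 1)
    (h3 : AdjLastThree G 3) (h5 : AdjLastThree G 5) (h0 : ¬ AdjLastThree G 0)
    (h2 : ¬ AdjLastThree G 2) : ContainsListed G := by
  by_cases h06 : G.Adj 0 6; swap
  · exact containsListed_of_linked_at_six hG h01 h23 h45 h13 h1 h3 h5 h06 h2
  by_cases h07 : G.Adj 0 7; swap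
  · exact .of_comap ![0, 1, 2, 3, 4, 5, 7, 6, 8] (by decide) (containsListed_of_linked_at_six
      (not_colorable_comap hG _ (by decide)) h01 h23 h45 h13 ⟨h1.2.1, h1.1, h1.2.2⟩
      ⟨h3.2.1, h3.1, h3.2.2⟩ ⟨h5.2.1, h5.1, h5.2.2⟩ h07 fun h => h2 ⟨h.2.1, h.1, h.2.2⟩)
  have h08 : ¬ G.Adj 0 8 := fun h => h0 ⟨h06, h07, h⟩
  exact .of_comap ![0, 1, 2, 3, 4, 5, 8, 7, 6] (by decide) (containsListed_of_linked_at_six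
    (not_colorable_comap hG _ (by decide)) h01 h23 h45 h13 ⟨h1.2.2, h1.2.1, h1.1⟩
    ⟨h3.2.2, h3.2.1, h3.1⟩ ⟨h5.2.2, h5.2.1, h5.1⟩ h08 fun h => h2 ⟨h.2.2, h.2.1, h.1⟩)

lemma containsListed_of_unlinked_at_six (hG : ¬ G.Colorable 5) (h01 : ¬ G.Adj 0 1)
    (h23 : ¬ G.Adj 2 3) (h45 : ¬ G.Adj 4 5) (h13 : G.Adj 1 3) (h1 : AdjLastThree G 1)
    (h3 : AdjLastThree G 3) (h4 : AdjLastThree G 4) (h5 : AdjLastThree G 5) (h06 : ¬ G.Adj 0 6)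
    (h2 : ¬ AdjLastThree G 2) : ContainsListed G := by
  have h67 : G.Adj 6 7 := by
    have := adj_of_four_pairs hG 0 1 2 3 4 5 6 7 8 (by decide); tauto
  have h68 : G.Adj 6 8 := by
    have := adj_of_four_pairs hG 0 1 2 3 4 5 6 8 7 (by decide); tauto
  have h78 : G.Adj 7 8 := by
    have := adj_of_four_pairs hG 0 1 2 3 4 5 7 8 6 (by decide); tauto
  have h145 : G.Adj 1 4 ∨ G.Adj 1 5 := by
    simpa [h45, h06, h23] using adj_of_triple_two_pairs hG 1 4 5 0 6 2 3 7 8 (by decide)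
  have h345 : G.Adj 3 4 ∨ G.Adj 3 5 := by
    by_contra! h
    refine h2 ⟨?_, ?_, ?_⟩
    · simpa [h, h45, h01] using adj_of_triple_two_pairs hG 3 4 5 2 6 0 1 7 8 (by decide)
    · simpa [h, h45, h01] using adj_of_triple_two_pairs hG 3 4 5 2 7 0 1 6 8 (by decide)
    · simpa [h, h45, h01] using adj_of_triple_two_pairs hG 3 4 5 2 8 0 1 6 7 (by decide)
  obtain ⟨h16, h17, h18⟩ := h1
  obtain ⟨h36, h37, h38⟩ := h3
  obtain ⟨h46, h47, h48⟩ := h4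
  obtain ⟨h56, h57, h58⟩ := h5
  by_cases h14 : G.Adj 1 4
  · by_cases h34 : G.Adj 3 4
    · refine containsListed_of_six ![1, 3, 4, 6, 7, 8] fun i j hij => ?_
      fin_cases i <;> fin_cases j <;> first | exact absurd hij (by decide) | assumption
    have h35 : G.Adj 3 5 := h345.resolve_left h34
    by_cases h15 : G.Adj 1 5
    · refine containsListed_of_six ![1, 3, 5, 6, 7, 8] fun i j hij => ?_
      fin_cases i <;> fin_cases j <;> first | exact absurd hij (by decide) | assumption
    have h27 : G.Adj 2 7 := by
      simpa [h06, h15, h34] using adj_of_four_pairs hG 0 6 1 5 3 4 2 7 8 (by decide)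
    have h28 : G.Adj 2 8 := by
      simpa [h06, h15, h34] using adj_of_four_pairs hG 0 6 1 5 3 4 2 8 7 (by decide)
    have h26 : ¬ G.Adj 2 6 := fun h => h2 ⟨h, h27, h28⟩
    have h07 : G.Adj 0 7 := by
      simpa [h26, h15, h34] using adj_of_four_pairs hG 0 7 1 5 3 4 2 6 8 (by decide)
    have h08 : G.Adj 0 8 := by
      simpa [h26, h15, h34] using adj_of_four_pairs hG 0 8 1 5 3 4 2 6 7 (by decide)
    refine .of_comap ![6, 0, 1, 5, 4, 3, 2, 7, 8] (by decide) (containsListed_of_seven_cycle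
      (not_colorable_comap hG _ (by decide)) (adj_comap_of_fixed (by decide) rfl fun i hi => ?_)
      (adj_comap_of_fixed (by decide) rfl fun i hi => ?_) (mt G.adj_symm h06) h01 h15
      (mt G.adj_symm h45) (mt G.adj_symm h34) (mt G.adj_symm h23) (mt G.adj_symm h26)) <;>
    fin_cases i <;> first
      | exact absurd rfl hi
      | assumption
      | (refine G.adj_symm ?_; assumption)
  · have h15 : G.Adj 1 5 := h145.resolve_left h14
    by_cases h35 : G.Adj 3 5
    · refine containsListed_of_six ![1, 3, 5, 6, 7, 8] fun i j hij => ?_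
      fin_cases i <;> fin_cases j <;> first | exact absurd hij (by decide) | assumption
    have h27 : G.Adj 2 7 := by
      simpa [h06, h14, h35] using adj_of_four_pairs hG 0 6 1 4 3 5 2 7 8 (by decide)
    have h28 : G.Adj 2 8 := by
      simpa [h06, h14, h35] using adj_of_four_pairs hG 0 6 1 4 3 5 2 8 7 (by decide)
    have h26 : ¬ G.Adj 2 6 := fun h => h2 ⟨h, h27, h28⟩
    have h07 : G.Adj 0 7 := by
      simpa [h26, h14, h35] using adj_of_four_pairs hG 0 7 1 4 3 5 2 6 8 (by decide)
    have h08 : G.Adj 0 8 := by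
      simpa [h26, h14, h35] using adj_of_four_pairs hG 0 8 1 4 3 5 2 6 7 (by decide)
    refine .of_comap ![6, 0, 1, 4, 5, 3, 2, 7, 8] (by decide) (containsListed_of_seven_cycle
      (not_colorable_comap hG _ (by decide)) (adj_comap_of_fixed (by decide) rfl fun i hi => ?_)
      (adj_comap_of_fixed (by decide) rfl fun i hi => ?_) (mt G.adj_symm h06) h01 h14 h45
      (mt G.adj_symm h35) (mt G.adj_symm h23) (mt G.adj_symm h26)) <;>
    fin_cases i <;> first
      | exact absurd rfl hi
      | assumption
      | (refine G.adj_symm ?_; assumption)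

/-- Two of the three matching edges are attached to the last three vertices. -/
lemma containsListed_of_two_attached (hG : ¬ G.Colorable 5) (h01 : ¬ G.Adj 0 1)
    (h23 : ¬ G.Adj 2 3) (h45 : ¬ G.Adj 4 5) (h1 : AdjLastThree G 1) (h3 : AdjLastThree G 3)
    (h5 : AdjLastThree G 5) (h0 : ¬ AdjLastThree G 0) (h2 : ¬ AdjLastThree G 2) :
    ContainsListed G := by
  by_cases h13 : G.Adj 1 3; swap
  · exact containsListed_of_linked hG h01 h23 h45 h13 h1 h3 h5 h0 h2
  by_cases h4 : AdjLastThree G 4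
  · by_cases h06 : G.Adj 0 6; swap
    · exact containsListed_of_unlinked_at_six hG h01 h23 h45 h13 h1 h3 h4 h5 h06 h2
    by_cases h07 : G.Adj 0 7; swap
    · exact .of_comap ![0, 1, 2, 3, 4, 5, 7, 6, 8] (by decide)
        (containsListed_of_unlinked_at_six (not_colorable_comap hG _ (by decide)) h01 h23 h45 h13
          ⟨h1.2.1, h1.1, h1.2.2⟩ ⟨h3.2.1, h3.1, h3.2.2⟩ ⟨h4.2.1, h4.1, h4.2.2⟩
          ⟨h5.2.1, h5.1, h5.2.2⟩ h07 fun h => h2 ⟨h.2.1, h.1, h.2.2⟩)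
    have h08 : ¬ G.Adj 0 8 := fun h => h0 ⟨h06, h07, h⟩
    exact .of_comap ![0, 1, 2, 3, 4, 5, 8, 7, 6] (by decide)
      (containsListed_of_unlinked_at_six (not_colorable_comap hG _ (by decide)) h01 h23 h45 h13
        ⟨h1.2.2, h1.2.1, h1.1⟩ ⟨h3.2.2, h3.2.1, h3.1⟩ ⟨h4.2.2, h4.2.1, h4.1⟩
        ⟨h5.2.2, h5.2.1, h5.1⟩ h08 fun h => h2 ⟨h.2.2, h.2.1, h.1⟩)
  · by_cases h15 : G.Adj 1 5; swap
    · exact .of_comap ![0, 1, 4, 5, 2, 3, 6, 7, 8] (by decide) (containsListed_of_linked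
        (not_colorable_comap hG _ (by decide)) h01 h45 h23 h15 h1 h5 h3 h0 h4)
    by_cases h35 : G.Adj 3 5; swap
    · exact .of_comap ![2, 3, 4, 5, 0, 1, 6, 7, 8] (by decide) (containsListed_of_linked
        (not_colorable_comap hG _ (by decide)) h23 h45 h01 h35 h3 h5 h1 h2 h4)
    have h67 : G.Adj 6 7 := by
      have := adj_of_four_pairs hG 0 1 2 3 4 5 6 7 8 (by decide); tauto
    have h68 : G.Adj 6 8 := by
      have := adj_of_four_pairs hG 0 1 2 3 4 5 6 8 7 (by decide); tauto
    have h78 : G.Adj 7 8 := by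
      have := adj_of_four_pairs hG 0 1 2 3 4 5 7 8 6 (by decide); tauto
    obtain ⟨h16, h17, h18⟩ := h1
    obtain ⟨h36, h37, h38⟩ := h3
    obtain ⟨h56, h57, h58⟩ := h5
    refine containsListed_of_six ![1, 3, 5, 6, 7, 8] fun i j hij => ?_
    fin_cases i <;> fin_cases j <;> first | exact absurd hij (by decide) | assumption

lemma not_two_colorable_induce (hG : ¬ G.Colorable 5) (Q : Finset (Fin 9)) (d : Fin 9 → Fin 5)
    (hd : ∀ v ∉ Q, 2 ≤ d v) (hd' : ∀ v ∉ Q, ∀ w ∉ Q, G.Adj v w → d v ≠ d w) :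
    ¬ (G.induce (Q : Set (Fin 9))).Colorable 2 := by
  rintro ⟨c⟩
  refine hG ⟨Coloring.mk (fun v => if h : v ∈ Q then (c ⟨v, h⟩).castLE (by norm_num) else d v)
    fun {v w} hvw => ?_⟩
  have small : ∀ x : Fin 2, ∀ y : Fin 5, 2 ≤ y → x.castLE (by norm_num) ≠ y := by decide
  by_cases hv : v ∈ Q <;> by_cases hw : w ∈ Q <;> simp only [hv, hw, dif_pos, dif_neg,
    not_false_eq_true]
  · intro h
    exact c.valid (v := ⟨v, hv⟩) (w := ⟨w, hw⟩) hvw (Fin.castLE_injective _ h)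
  · exact small _ _ (hd w hw)
  · exact (small _ _ (hd v hv)).symm
  · exact hd' v hv w hw hvw

/-- At most one of the three matching edges is attached to the last three vertices. -/
lemma containsListed_of_one_attached (hG : ¬ G.Colorable 5) (h67 : G.Adj 6 7) (h68 : G.Adj 6 8)
    (h78 : G.Adj 7 8) (h1 : AdjLastThree G 1) (h2 : AdjLastThree G 2) (h3 : AdjLastThree G 3)
    (h4 : AdjLastThree G 4) (h5 : AdjLastThree G 5) : ContainsListed G := by
  have hu : ∀ i j, i ≠ j → G.Adj (![6, 7, 8] i) (![6, 7, 8] j) := by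
    intro i j hij
    fin_cases i <;> fin_cases j <;> first
      | exact absurd rfl hij
      | assumption
      | (refine G.adj_symm ?_; assumption)
  have hlast : ∀ v, AdjLastThree G v → ∀ i, G.Adj (![6, 7, 8] i) v := by
    intro v hv i
    fin_cases i
    exacts [hv.1.symm, hv.2.1.symm, hv.2.2.symm]
  by_cases h0 : AdjLastThree G 0
  · refine containsListed_of_triangle_join ![6, 7, 8] hu {0, 1, 2, 3, 4, 5} (by decide) ?_
      (not_two_colorable_induce hG _ ![0, 0, 0, 0, 0, 0, 2, 3, 4] (by decide) ?_)
    · intro i q hq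
      simp only [Finset.mem_insert, Finset.mem_singleton] at hq
      rcases hq with rfl | rfl | rfl | rfl | rfl | rfl <;> exact hlast _ (by assumption) i
    · have key : ∀ v w : Fin 9, v ∉ ({0, 1, 2, 3, 4, 5} : Finset (Fin 9)) →
          w ∉ ({0, 1, 2, 3, 4, 5} : Finset (Fin 9)) →
          (![0, 0, 0, 0, 0, 0, 2, 3, 4] : Fin 9 → Fin 5) v =
            (![0, 0, 0, 0, 0, 0, 2, 3, 4] : Fin 9 → Fin 5) w → v = w := by decide
      exact fun v hv w hw hvw h => hvw.ne (key v w hv hw h)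
  · obtain ⟨k, hk6, hk⟩ : ∃ k : Fin 9, 6 ≤ k ∧ ¬ G.Adj 0 k := by
      by_contra! h
      exact h0 ⟨h _ (by decide), h _ (by decide), h _ (by decide)⟩
    refine containsListed_of_triangle_join ![6, 7, 8] hu {1, 2, 3, 4, 5} (by decide) ?_
      (not_two_colorable_induce hG _
        (fun v => ![0, 0, 0, 0, 0, 0, 2, 3, 4] (if v = 0 then k else v)) ?_ ?_)
    · intro i q hq
      simp only [Finset.mem_insert, Finset.mem_singleton] at hq
      rcases hq with rfl | rfl | rfl | rfl | rfl <;> exact hlast _ (by assumption) i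
    · clear hk; revert k; decide
    · have key : ∀ k v w : Fin 9, 6 ≤ k → v ∉ ({1, 2, 3, 4, 5} : Finset (Fin 9)) →
          w ∉ ({1, 2, 3, 4, 5} : Finset (Fin 9)) →
          (![0, 0, 0, 0, 0, 0, 2, 3, 4] : Fin 9 → Fin 5) (if v = 0 then k else v) =
            (![0, 0, 0, 0, 0, 0, 2, 3, 4] : Fin 9 → Fin 5) (if w = 0 then k else w) →
          v = w ∨ v = 0 ∧ w = k ∨ v = k ∧ w = 0 := by decide
      intro v hv w hw hvw h
      rcases key k v w hk6 hv hw h with rfl | ⟨rfl, rfl⟩ | ⟨rfl, rfl⟩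
      · exact hvw.ne rfl
      · exact hk hvw
      · exact hk hvw.symm

lemma containsListed_of_oriented_matching (hG : ¬ G.Colorable 5) (h01 : ¬ G.Adj 0 1)
    (h23 : ¬ G.Adj 2 3) (h45 : ¬ G.Adj 4 5) (h1 : AdjLastThree G 1) (h3 : AdjLastThree G 3)
    (h5 : AdjLastThree G 5) : ContainsListed G := by
  have h67 : G.Adj 6 7 := by
    have := adj_of_four_pairs hG 0 1 2 3 4 5 6 7 8 (by decide); tauto
  have h68 : G.Adj 6 8 := by
    have := adj_of_four_pairs hG 0 1 2 3 4 5 6 8 7 (by decide); tauto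
  have h78 : G.Adj 7 8 := by
    have := adj_of_four_pairs hG 0 1 2 3 4 5 7 8 6 (by decide); tauto
  by_cases h0 : AdjLastThree G 0
  · by_cases h2 : AdjLastThree G 2
    · exact .of_comap ![4, 0, 1, 2, 3, 5, 6, 7, 8] (by decide) (containsListed_of_one_attached
        (not_colorable_comap hG _ (by decide)) h67 h68 h78 h0 h1 h2 h3 h5)
    by_cases h4 : AdjLastThree G 4
    · exact .of_comap ![2, 0, 1, 3, 4, 5, 6, 7, 8] (by decide) (containsListed_of_one_attached
        (not_colorable_comap hG _ (by decide)) h67 h68 h78 h0 h1 h3 h4 h5)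
    exact .of_comap ![2, 3, 4, 5, 0, 1, 6, 7, 8] (by decide) (containsListed_of_two_attached
      (not_colorable_comap hG _ (by decide)) h23 h45 h01 h3 h5 h1 h2 h4)
  · by_cases h2 : AdjLastThree G 2; swap
    · exact containsListed_of_two_attached hG h01 h23 h45 h1 h3 h5 h0 h2
    by_cases h4 : AdjLastThree G 4; swap
    · exact .of_comap ![0, 1, 4, 5, 2, 3, 6, 7, 8] (by decide) (containsListed_of_two_attached
        (not_colorable_comap hG _ (by decide)) h01 h45 h23 h1 h5 h3 h0 h4)
    exact containsListed_of_one_attached hG h67 h68 h78 h1 h2 h3 h4 h5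

/-- One end of the matching edge `01` is adjacent to all of the last three vertices. -/
lemma adjLastThree_or (hG : ¬ G.Colorable 5) (h01 : ¬ G.Adj 0 1) (h23 : ¬ G.Adj 2 3)
    (h45 : ¬ G.Adj 4 5) : AdjLastThree G 0 ∨ AdjLastThree G 1 := by
  have a66 : G.Adj 0 6 ∨ G.Adj 1 6 := by
    simpa [h01, h23, h45] using adj_of_triple_two_pairs hG 0 1 6 2 3 4 5 7 8 (by decide)
  have a77 : G.Adj 0 7 ∨ G.Adj 1 7 := by
    simpa [h01, h23, h45] using adj_of_triple_two_pairs hG 0 1 7 2 3 4 5 6 8 (by decide)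
  have a88 : G.Adj 0 8 ∨ G.Adj 1 8 := by
    simpa [h01, h23, h45] using adj_of_triple_two_pairs hG 0 1 8 2 3 4 5 6 7 (by decide)
  have a67 : G.Adj 0 6 ∨ G.Adj 1 7 := by
    simpa [h01, h23, h45] using adj_of_four_pairs hG 0 6 1 7 2 3 4 5 8 (by decide)
  have a68 : G.Adj 0 6 ∨ G.Adj 1 8 := by
    simpa [h01, h23, h45] using adj_of_four_pairs hG 0 6 1 8 2 3 4 5 7 (by decide)
  have a76 : G.Adj 0 7 ∨ G.Adj 1 6 := by
    simpa [h01, h23, h45] using adj_of_four_pairs hG 0 7 1 6 2 3 4 5 8 (by decide)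
  have a78 : G.Adj 0 7 ∨ G.Adj 1 8 := by
    simpa [h01, h23, h45] using adj_of_four_pairs hG 0 7 1 8 2 3 4 5 6 (by decide)
  have a86 : G.Adj 0 8 ∨ G.Adj 1 6 := by
    simpa [h01, h23, h45] using adj_of_four_pairs hG 0 8 1 6 2 3 4 5 7 (by decide)
  have a87 : G.Adj 0 8 ∨ G.Adj 1 7 := by
    simpa [h01, h23, h45] using adj_of_four_pairs hG 0 8 1 7 2 3 4 5 6 (by decide)
  clear hG h01 h23 h45
  unfold AdjLastThree
  grind

lemma containsListed_of_three_matching (hG : ¬ G.Colorable 5) (h01 : ¬ G.Adj 0 1)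
    (h23 : ¬ G.Adj 2 3) (h45 : ¬ G.Adj 4 5) : ContainsListed G := by
  wlog h1 : AdjLastThree G 1 generalizing G with H
  · exact .of_comap ![1, 0, 2, 3, 4, 5, 6, 7, 8] (by decide) (H
      (not_colorable_comap hG _ (by decide)) (mt G.adj_symm h01) h23 h45
      ((adjLastThree_or hG h01 h23 h45).resolve_right h1))
  wlog h3 : AdjLastThree G 3 generalizing G with H
  · have := adjLastThree_or (not_colorable_comap hG ![2, 3, 0, 1, 4, 5, 6, 7, 8] (by decide))
      h23 h01 h45
    exact .of_comap ![0, 1, 3, 2, 4, 5, 6, 7, 8] (by decide) (H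
      (not_colorable_comap hG _ (by decide)) h01 (mt G.adj_symm h23) h45 h1
      (this.resolve_right h3))
  wlog h5 : AdjLastThree G 5 generalizing G with H
  · have := adjLastThree_or (not_colorable_comap hG ![4, 5, 0, 1, 2, 3, 6, 7, 8] (by decide))
      h45 h01 h23
    exact .of_comap ![0, 1, 2, 3, 5, 4, 6, 7, 8] (by decide) (H
      (not_colorable_comap hG _ (by decide)) h01 h23 (mt G.adj_symm h45) h1 h3
      (this.resolve_right h5))
  exact containsListed_of_oriented_matching hG h01 h23 h45 h1 h3 h5

lemma exists_perm_extending {n : ℕ} (hn : n ≤ 9) (v : Fin n → Fin 9) (hv : Function.Injective v) :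
    ∃ σ : Equiv.Perm (Fin 9), ∀ i, σ (i.castLE hn) = v i := by
  obtain ⟨σ, hσ⟩ := (Equiv.Perm.isMultiplyPretransitive (Fin 9) n).exists_smul_eq
    (Fin.castLEEmb hn) ⟨v, hv⟩
  exact ⟨σ, fun i => DFunLike.congr_fun hσ i⟩

lemma containsListed_of_three_pairs (hG : ¬ G.Colorable 5) (a b c d e f : Fin 9)
    (hv : [a, b, c, d, e, f].Nodup) (hab : ¬ G.Adj a b) (hcd : ¬ G.Adj c d)
    (hef : ¬ G.Adj e f) : ContainsListed G := by
  obtain ⟨σ, hσ⟩ := exists_perm_extending (by norm_num) ![a, b, c, d, e, f] (List.nodup_ofFn.mp hv)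
  refine .of_comap σ σ.injective (containsListed_of_three_matching
    (not_colorable_comap hG _ σ.injective) ?_ ?_ ?_)
  · rwa [comap_adj, show σ 0 = a from hσ 0, show σ 1 = b from hσ 1]
  · rwa [comap_adj, show σ 2 = c from hσ 2, show σ 3 = d from hσ 3]
  · rwa [comap_adj, show σ 4 = e from hσ 4, show σ 5 = f from hσ 5]

lemma containsListed_of_two_matching (hG : ¬ G.Colorable 5) (h01 : ¬ G.Adj 0 1)
    (h23 : ¬ G.Adj 2 3) : ContainsListed G := by
  by_contra hcon
  have hclique : ∀ i j, 4 ≤ i → i < j → G.Adj i j := by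
    intro i j hi hij
    by_contra h
    exact hcon (containsListed_of_three_pairs hG 0 1 2 3 i j
      (by clear * - hi hij; revert i j; decide) h01 h23 h)
  have hmiss : ∀ u, ∃ f, 4 ≤ f ∧ ¬ G.Adj u f := by
    intro u
    by_contra! h
    refine hcon (containsListed_of_six ![u, 4, 5, 6, 7, 8] fun i j hij => ?_)
    fin_cases i <;> fin_cases j <;> first
      | exact absurd hij (by decide)
      | exact h _ (by clear * -; revert u; decide)
      | exact hclique _ _ (by clear * -; revert u; decide) (by clear * -; revert u; decide)
  obtain ⟨f, hf, h0f⟩ := hmiss 0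
  obtain ⟨g, hg, h2g⟩ := hmiss 2
  have h0 : ∀ x y, 4 ≤ x → 4 ≤ y → ¬ G.Adj 0 x → ¬ G.Adj 1 y → x = y := by
    intro x y hx hy h h'
    by_contra hxy
    exact hcon (containsListed_of_three_pairs hG 0 x 1 y 2 3
      (by clear * - hx hy hxy; revert x y; decide) h h' h23)
  have h2 : ∀ x y, 4 ≤ x → 4 ≤ y → ¬ G.Adj 2 x → ¬ G.Adj 3 y → x = y := by
    intro x y hx hy h h'
    by_contra hxy
    exact hcon (containsListed_of_three_pairs hG 2 x 3 y 0 1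
      (by clear * - hx hy hxy; revert x y; decide) h h' h01)
  have h1f : ¬ G.Adj 1 f := by
    obtain ⟨f', hf', h⟩ := hmiss 1
    rwa [h0 f f' hf hf' h0f h]
  have h3g : ¬ G.Adj 3 g := by
    obtain ⟨g', hg', h⟩ := hmiss 3
    rwa [h2 g g' hg hg' h2g h]
  by_cases hfg : f = g
  · subst hfg
    obtain ⟨x, y, z, t, hx, hxy, hyz, hzt, hxf, hyf, hzf, htf, hnodup⟩ : ∃ x y z t : Fin 9,
        4 ≤ x ∧ x < y ∧ y < z ∧ z < t ∧ x ≠ f ∧ y ≠ f ∧ z ≠ f ∧ t ≠ f ∧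
          [0, 1, 2, 3, f, x, y, z, t].Nodup := by
      clear * - hf
      fin_cases f
      on_goal 5 => exact ⟨5, 6, 7, 8, by decide⟩
      on_goal 5 => exact ⟨4, 6, 7, 8, by decide⟩
      on_goal 5 => exact ⟨4, 5, 7, 8, by decide⟩
      on_goal 5 => exact ⟨4, 5, 6, 8, by decide⟩
      on_goal 5 => exact ⟨4, 5, 6, 7, by decide⟩
      all_goals exact absurd hf (by decide)
    have a0 : ∀ i, 4 ≤ i → i ≠ f → G.Adj 0 i := fun i hi hif => by
      by_contra h; exact hif (h0 i f hi hf h h1f)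
    have a1 : ∀ i, 4 ≤ i → i ≠ f → G.Adj 1 i := fun i hi hif => by
      by_contra h; exact hif (h0 f i hf hi h0f h).symm
    have a2 : ∀ i, 4 ≤ i → i ≠ f → G.Adj 2 i := fun i hi hif => by
      by_contra h; exact hif (h2 i f hi hf h h3g)
    have a3 : ∀ i, 4 ≤ i → i ≠ f → G.Adj 3 i := fun i hi hif => by
      by_contra h; exact hif (h2 f i hf hi h2g h).symm
    have hy : 4 ≤ y := hx.trans hxy.le
    have hz : 4 ≤ z := hy.trans hyz.le
    have ht : 4 ≤ t := hz.trans hzt.le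
    have hxz := hxy.trans hyz
    have hyt := hyz.trans hzt
    have hxt := hxz.trans hzt
    have six : ∀ u w, (∀ i, 4 ≤ i → i ≠ f → G.Adj u i) → (∀ i, 4 ≤ i → i ≠ f → G.Adj w i) →
        ¬ G.Adj u w := by
      intro u w hu hw huw
      refine hcon (containsListed_of_six ![u, w, x, y, z, t] fun i j hij => ?_)
      fin_cases i <;> fin_cases j <;> first
        | exact absurd hij (by decide)
        | exact huw
        | exact hu _ (by assumption) (by assumption)
        | exact hw _ (by assumption) (by assumption)
        | exact hclique _ _ (by assumption) (by assumption)
    simpa [h01, h23, h0f, h1f, h2g, h3g, six 0 2 a0 a2, six 0 3 a0 a3, six 1 2 a1 a2,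
      six 1 3 a1 a3] using adj_of_quintuple hG 0 1 2 3 f x y z t hnodup
  · obtain ⟨x, y, z, hnodup⟩ : ∃ x y z : Fin 9, [0, 1, f, 2, 3, g, x, y, z].Nodup := by
      clear * - hf hg hfg
      revert f g
      decide
    simpa [h01, h23, h0f, h1f, h2g, h3g] using adj_of_two_triples hG 0 1 f 2 3 g x y z hnodup

lemma containsListed_of_not_colorable (hG : ¬ G.Colorable 5) : ContainsListed G := by
  by_contra hcon
  have hsix : ∀ v : Fin 6 → Fin 9, ∃ i j, i < j ∧ ¬ G.Adj (v i) (v j) := by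
    intro v
    by_contra! h
    exact hcon (containsListed_of_six v h)
  obtain ⟨i, j, hij, hadj⟩ := hsix (Fin.castLE (by norm_num))
  obtain ⟨σ, hσ⟩ := exists_perm_extending (by norm_num)
    ![i.castLE (by norm_num : 6 ≤ 9), j.castLE (by norm_num)] (by
      simpa [Function.Injective, Fin.forall_fin_two] using ⟨hij.ne, hij.ne'⟩)
  obtain ⟨k, l, hkl, hadj'⟩ := hsix fun k => σ (k.addNat 2 |>.castLE (by norm_num))
  obtain ⟨τ, hτ⟩ := exists_perm_extending (n := 4) (by norm_num)
    ![0, 1, k.addNat 2 |>.castLE (by norm_num), l.addNat 2 |>.castLE (by norm_num)]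
    (by clear * - hkl; revert k l; decide)
  refine hcon (.of_comap (σ * τ) (σ * τ).injective (containsListed_of_two_matching
    (not_colorable_comap hG _ (σ * τ).injective) ?_ ?_))
  · rw [comap_adj, Equiv.Perm.mul_apply, Equiv.Perm.mul_apply, show τ 0 = 0 from hτ 0,
      show τ 1 = 1 from hτ 1, show σ 0 = _ from hσ 0, show σ 1 = _ from hσ 1]
    exact hadj
  · rw [comap_adj, Equiv.Perm.mul_apply, Equiv.Perm.mul_apply, show τ 2 = _ from hτ 2,
      show τ 3 = _ from hτ 3]
    exact hadj'

end FinNine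

lemma HasSubgraphIso.of_map {V W X : Type*} {P : SimpleGraph W} {G : SimpleGraph V} (f : V ↪ X)
    (hP : ∀ p, ∃ q, P.Adj p q) (h : HasSubgraphIso P (G.map f)) : HasSubgraphIso P G := by
  obtain ⟨g, hg⟩ := h
  have hrange : ∀ p, ∃ v, f v = g p := by
    intro p
    obtain ⟨q, hq⟩ := hP p
    obtain ⟨v, _, _, hv, _⟩ := (map_adj f G _ _).mp (g.map_rel hq)
    exact ⟨v, hv⟩
  choose k hk using hrange
  refine ⟨⟨k, fun {p q} h => ?_⟩, fun p q h => hg ?_⟩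
  · have := g.map_rel h
    rwa [← hk, ← hk, map_adj_apply] at this
  · rw [← hk, ← hk]
    exact congrArg f h

lemma exists_adj_join_two {W : Type*} (P : SimpleGraph W) (p : Fin 2 ⊕ W) :
    ∃ q, (graphJoin (⊤ : SimpleGraph (Fin 2)) P).Adj p q := by
  rcases p with i | w
  · exact ⟨.inl (i + 1), by simp, .inl (by simp)⟩
  · exact ⟨.inl 0, by simp, .inr trivial⟩

lemma ContainsListed.of_map {V X : Type*} {G : SimpleGraph V} (f : V ↪ X)
    (h : ContainsListed (G.map f)) : ContainsListed G := by
  rcases h with h | h | h | h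
  · exact .inl (h.of_map f (by decide))
  · refine .inr (.inl (h.of_map f ?_))
    rintro (i | i)
    · exact ⟨.inr 0, by simp, .inl trivial⟩
    · exact ⟨.inl 0, by simp, .inr trivial⟩
  · exact .inr (.inr (.inl (h.of_map f (exists_adj_join_two _))))
  · exact .inr (.inr (.inr (h.of_map f (exists_adj_join_two _))))

lemma containsListed_of_card_le {V : Type*} [Fintype V] {G : SimpleGraph V}
    (hG : ¬ G.Colorable 5) (hcard : Fintype.card V ≤ 9) : ContainsListed G := by
  obtain ⟨f⟩ := Function.Embedding.nonempty_of_card_le (α := V) (β := Fin 9) (by simpa using hcard)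
  exact .of_map f (containsListed_of_not_colorable fun h =>
    hG (h.of_hom (Embedding.map f G).toHom))

lemma not_colorable_join_two_M7 :
    ¬ (graphJoin (⊤ : SimpleGraph (Fin 2)) M7).Colorable 5 := by
  rintro ⟨c⟩
  have hM : ∀ i j : Fin 7, M7.Adj i j → c (.inr i) ≠ c (.inr j) := fun i j h =>
    c.valid ⟨by simpa using h.ne, .inl h⟩
  have hK : ∀ (i : Fin 2) (j : Fin 7), c (.inl i) ≠ c (.inr j) := fun i j =>
    c.valid ⟨by simp, .inl trivial⟩
  have hKK : c (.inl 0) ≠ c (.inl 1) := c.valid ⟨by simp, .inl (by simp)⟩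
  simp only [M7, fromRel_adj] at hM
  have e (i j : Fin 7) (h : i ≠ j) (h' : (i.val, j.val) ∈
    [(0,1), (1,2), (2,3), (3,4), (4,5), (5,0), (0,2), (2,4), (4,0), (6,1), (6,3), (6,5)]) :=
    hM i j ⟨h, .inl h'⟩
  have e01 := e 0 1 (by decide) (by decide)
  have e12 := e 1 2 (by decide) (by decide)
  have e23 := e 2 3 (by decide) (by decide)
  have e34 := e 3 4 (by decide) (by decide)
  have e45 := e 4 5 (by decide) (by decide)
  have e50 := e 5 0 (by decide) (by decide)
  have e02 := e 0 2 (by decide) (by decide)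
  have e24 := e 2 4 (by decide) (by decide)
  have e40 := e 4 0 (by decide) (by decide)
  have e61 := e 6 1 (by decide) (by decide)
  have e63 := e 6 3 (by decide) (by decide)
  have e65 := e 6 5 (by decide) (by decide)
  have k0 := hK 0
  have k1 := hK 1
  have full : ∀ p q r s t x : Fin 5, p ≠ q → p ≠ r → p ≠ s → p ≠ t → q ≠ r → q ≠ s → q ≠ t →
      r ≠ s → r ≠ t → s ≠ t → x = p ∨ x = q ∨ x = r ∨ x = s ∨ x = t := by
    intros; omega
  have tri := fun j => full _ _ _ _ _ (c (.inr j)) hKK (k0 0) (k0 2) (k0 4) (k1 0) (k1 2) (k1 4)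
    e02 e40.symm e24
  have h1 : c (.inr 1) = c (.inr 4) := by
    rcases tri 1 with h | h | h | h | h
    exacts [absurd h.symm (k0 1), absurd h.symm (k1 1), absurd h.symm e01, absurd h e12, h]
  have h3 : c (.inr 3) = c (.inr 0) := by
    rcases tri 3 with h | h | h | h | h
    exacts [absurd h.symm (k0 3), absurd h.symm (k1 3), h, absurd h.symm e23, absurd h e34]
  have h5 : c (.inr 5) = c (.inr 2) := by
    rcases tri 5 with h | h | h | h | h
    exacts [absurd h.symm (k0 5), absurd h.symm (k1 5), absurd h e50, h, absurd h.symm e45]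
  rcases tri 6 with h | h | h | h | h
  exacts [k0 6 h.symm, k1 6 h.symm, e63 (h.trans h3.symm), e65 (h.trans h5.symm),
    e61 (h.trans h1.symm)]

/-- A `t`-critical graph has no proper subgraph that is not `(t - 1)`-colorable. -/
lemma IsCritical.nonempty_iso {t : ℕ} {V W : Type*} {G : SimpleGraph V} {P : SimpleGraph W}
    (hG : IsCritical t G) (hP : ¬ P.Colorable (t - 1)) (h : HasSubgraphIso P G) :
    Nonempty (G ≃g P) := by
  obtain ⟨f, hf⟩ := h
  have htop : (⊤ : P.Subgraph).map f = ⊤ := by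
    by_contra hne
    refine hP ((hG.2 _ hne).of_hom ⟨fun w => ⟨f w, w, trivial, rfl⟩, fun {v w} hvw => ?_⟩)
    exact ⟨v, w, hvw, rfl, rfl⟩
  have hsurj : Function.Surjective f := by
    intro v
    have hv : v ∈ ((⊤ : P.Subgraph).map f).verts := by rw [htop]; trivial
    obtain ⟨w, -, hw⟩ := hv
    exact ⟨w, hw⟩
  refine ⟨RelIso.symm ⟨Equiv.ofBijective f ⟨hf, hsurj⟩, fun {a b} => ⟨fun hab => ?_, f.map_rel⟩⟩⟩
  have hab' : ((⊤ : P.Subgraph).map f).Adj (f a) (f b) := by rw [htop]; exact hab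
  obtain ⟨a', b', h, ha, hb⟩ := hab'
  rwa [hf ha, hf hb] at h

/-- Every 6-critical graph with at most nine vertices either has a subgraph isomorphic
to `K_6`, `C_3 + C_5`, or `K_2 + H_7`, or is isomorphic to `K_2 + M_7`. -/
theorem six_critical_at_most_nine_vertices {V : Type} [Fintype V] (G : SimpleGraph V)
    (hG : IsCritical 6 G) (hcard : Fintype.card V ≤ 9) :
    HasSubgraphIso (⊤ : SimpleGraph (Fin 6)) G ∨
    HasSubgraphIso (graphJoin (cyc 3) (cyc 5)) G ∨
    HasSubgraphIso (graphJoin (⊤ : SimpleGraph (Fin 2)) H7) G ∨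
    Nonempty (G ≃g graphJoin (⊤ : SimpleGraph (Fin 2)) M7) := by
  rcases containsListed_of_card_le hG.1 hcard with h | h | h | h
  · exact .inl h
  · exact .inr (.inl h)
  · exact .inr (.inr (.inl h))
  · exact .inr (.inr (.inr (hG.nonempty_iso not_colorable_join_two_M7 h)))
end
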